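/- In BC_{r,t}, setting ỹ_i = s_i y_i s_i − (1 − c_i c_{i+1}) s_i and ỹ̄_i = s̄_i ȳ_i s̄_i − (1 + c̄_i c̄_{i+1}) s̄_i, the following identities hold for all admissible indices i, j, k, n (i.e. whenever every element occurring is defined): (1) s_j y_i = y_i s_j and s̄_j ȳ_i = ȳ_i s̄_j if j ≠ i−1, i; (2) s_j ȳ_i = ȳ_i s_j and s̄_j y_i = y_i s̄_j if j ≠ i−1; (3) y_i c_i = −c_i y_i and ȳ_i c̄_i = −c̄_i ȳ_i; (4) y_i c_j = c_j y_i and ȳ_i c̄_j = c̄_j ȳ_i if i ≠ j; (5) y_i c̄_j = c̄_j y_i and ȳ_i c_j = c_j ȳ_i if j ≥ i; (6) y_i y_{i+1} = y_{i+1} y_i and ȳ_i ȳ_{i+1} = ȳ_{i+1} ȳ_i; (7) y_i (e_i + ȳ_i − ē_i) = (e_i + ȳ_i − ē_i) y_i; (8) e_i ȳ_i = e_i (L_i − L̄_i) and e_i y_i = e_i (L̄_i − L_i); (9) e_i s_i y_i s_i = s_i y_i s_i e_i and e_j s̄_j ȳ_j s̄_j = s̄_j ȳ_j s̄_j e_j;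 (10) y_i ỹ_i = ỹ_i y_i and ȳ_i ỹ̄_i = ỹ̄_i ȳ_i; (11) e_i y_i^k c_i e_i = 0 for all k ∈ ℕ; (12) e_i y_i^{2n} e_i = 0 and e_i ȳ_i^{2n} e_i = 0 for all n ∈ ℕ; (13) e_i y_i e_i = e_i ȳ_i e_i = 0. -/

import Mathlib

open Polynomial

noncomputable section

/-- Transposition `(a b)` (0-based indices) in the symmetric group on `Fin n`;
it is `1` if an index is out of range. -/
def sw (n a b : ℕ) : Equiv.Perm (Fin n) :=
  if h : a < n ∧ b < n then Equiv.swap ⟨a, h.1⟩ ⟨b, h.2⟩ else 1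

/-- The permutation word `s_{i,j}` of the paper (1-based indices):
`s_{i,j} = s_i s_{i+1,j}` for `i < j`, `s_{i,i} = 1`, `s_{i,j} = s_{i,j+1} s_j` for `i > j`. -/
def sIJ (n i j : ℕ) : Equiv.Perm (Fin n) :=
  if i < j then ((List.range' i (j - i)).map (fun k => sw n (k - 1) k)).prod
  else ((List.range' j (i - j)).reverse.map (fun k => sw n (k - 1) k)).prod

/-- The coefficients `a_{2n+1,j}` of the paper: `acoef ω n j = a_{2n+1,j}`, defined by the
recursion `a_{1,0} = -1`, `a_{2n+1,j+1} = a_{2n-1,j}` and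
`a_{2n+1,0} = ∑_{j=0}^{n-1} a_{2n-1,j} ω_{2j+1}`. -/
def acoef {A : Type} [Ring A] (ω : ℕ → A) : ℕ → ℕ → A
  | 0, _ => -1
  | n + 1, 0 => ∑ j ∈ Finset.range (n + 1), acoef ω n j * ω (2 * j + 1)
  | n + 1, j + 1 => acoef ω n j

/-- The parameters `ω̄_k` determined by the parameters `ω` as in Corollary 3.5:
`ω̄_{2n} = 0` and `ω̄_{2n+1} = ∑_{j=0}^{n} a_{2n+1,j} ω_{2j+1}`. -/
def obar {R : Type} [CommRing R] (ω : ℕ → R) (k : ℕ) : R :=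
  if k % 2 = 0 then 0
  else ∑ j ∈ Finset.range (k / 2 + 1), acoef ω (k / 2) j * ω (2 * j + 1)

/-- Data for the presentation of the walled Brauer–Clifford superalgebra `BC_{r,t}`
(Definition 2.1 together with relations (2.1)–(2.3)) on an `R`-algebra `A`.
The images of the two symmetric groups are recorded as monoid homomorphisms, so the
symmetric group relations among the `s_i` (resp. `s̄_j`) hold automatically. -/
structure WBC (R A : Type) [CommRing R] [Ring A] [Algebra R A] (r t : ℕ) : Type where
  σ : Equiv.Perm (Fin r) →* A
  σb : Equiv.Perm (Fin t) →* A
  c : Fin r → A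
  cb : Fin t → A
  e : A
  c_sq : ∀ i, c i * c i = -1
  c_anti : ∀ i j, i ≠ j → c i * c j = -(c j * c i)
  c_conj : ∀ w i, σ w * c i * σ (w⁻¹) = c (w i)
  cb_sq : ∀ i, cb i * cb i = 1
  cb_anti : ∀ i j, i ≠ j → cb i * cb j = -(cb j * cb i)
  cb_conj : ∀ w i, σb w * cb i * σb (w⁻¹) = cb (w i)
  comm_σσb : ∀ w v, σ w * σb v = σb v * σ w
  comm_σcb : ∀ w j, σ w * cb j = cb j * σ w
  comm_σbc : ∀ v i, σb v * c i = c i * σb v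
  anti_ccb : ∀ i j, c i * cb j = -(cb j * c i)
  e_c1 : ∀ (h1 : 0 < r) (h2 : 0 < t), e * c ⟨0, h1⟩ = e * cb ⟨0, h2⟩
  c1_e : ∀ (h1 : 0 < r) (h2 : 0 < t), c ⟨0, h1⟩ * e = cb ⟨0, h2⟩ * e
  e_sq : e * e = 0
  e_s_e : 1 < r → e * σ (sw r 0 1) * e = e
  e_sb_e : 1 < t → e * σb (sw t 0 1) * e = e
  s_e_comm : ∀ i : ℕ, 0 < i → i + 1 < r → σ (sw r i (i + 1)) * e = e * σ (sw r i (i + 1))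
  sb_e_comm : ∀ j : ℕ, 0 < j → j + 1 < t → σb (sw t j (j + 1)) * e = e * σb (sw t j (j + 1))
  braid1 : 1 < r → 1 < t →
    e * σ (sw r 0 1) * σb (sw t 0 1) * e * σ (sw r 0 1)
      = e * σ (sw r 0 1) * σb (sw t 0 1) * e * σb (sw t 0 1)
  braid2 : 1 < r → 1 < t →
    σ (sw r 0 1) * e * σ (sw r 0 1) * σb (sw t 0 1) * e
      = σb (sw t 0 1) * e * σ (sw r 0 1) * σb (sw t 0 1) * e
  c_e_comm : ∀ i : Fin r, (i : ℕ) ≠ 0 → c i * e = e * c i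
  cb_e_comm : ∀ j : Fin t, (j : ℕ) ≠ 0 → cb j * e = e * cb j
  e_c_e : ∀ h : 0 < r, e * c ⟨0, h⟩ * e = 0
  e_cb_e : ∀ h : 0 < t, e * cb ⟨0, h⟩ * e = 0

namespace WBC

variable {R A : Type} [CommRing R] [Ring A] [Algebra R A] {r t : ℕ}

/-- The transposition `(i,j) ∈ Σ_r` (1-based indices). -/
def tr (d : WBC R A r t) (i j : ℕ) : A := d.σ (sw r (i - 1) (j - 1))

/-- The transposition `(ī,j̄) ∈ Σ_t` (1-based indices). -/
def trb (d : WBC R A r t) (i j : ℕ) : A := d.σb (sw t (i - 1) (j - 1))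

/-- The generator `s_j = (j, j+1)` (1-based). -/
def s (d : WBC R A r t) (j : ℕ) : A := d.σ (sw r (j - 1) j)

/-- The generator `s̄_j` (1-based). -/
def sb (d : WBC R A r t) (j : ℕ) : A := d.σb (sw t (j - 1) j)

/-- The generator `c_i` (1-based). -/
def cn (d : WBC R A r t) (i : ℕ) : A := if h : i - 1 < r then d.c ⟨i - 1, h⟩ else 0

/-- The generator `c̄_i` (1-based). -/
def cbn (d : WBC R A r t) (i : ℕ) : A := if h : i - 1 < t then d.cb ⟨i - 1, h⟩ else 0

/-- `e_{i,j} = (1̄,j̄)(1,i) e_1 (1,i)(1̄,j̄)` (1-based). -/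
def E (d : WBC R A r t) (i j : ℕ) : A := d.trb 1 j * d.tr 1 i * d.e * d.tr 1 i * d.trb 1 j

/-- `ē_{i,j} = c_i e_{i,j} c_i`. -/
def Eb (d : WBC R A r t) (i j : ℕ) : A := d.cn i * d.E i j * d.cn i

/-- `L'_i = ∑_{j=1}^{i-1} (j,i)`. -/
def LL (d : WBC R A r t) (i : ℕ) : A := ∑ j ∈ Finset.Ico 1 i, d.tr j i

/-- The Jucys–Murphy element `L_i = L'_i + c_i L'_i c_i`. -/
def L (d : WBC R A r t) (i : ℕ) : A := d.LL i + d.cn i * d.LL i * d.cn i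

/-- `L̄'_i = ∑_{j=1}^{i-1} (j̄,ī)`. -/
def LLb (d : WBC R A r t) (i : ℕ) : A := ∑ j ∈ Finset.Ico 1 i, d.trb j i

/-- The Jucys–Murphy element `L̄_i = L̄'_i - c̄_i L̄'_i c̄_i`. -/
def Lb (d : WBC R A r t) (i : ℕ) : A := d.LLb i - d.cbn i * d.LLb i * d.cbn i

/-- `y_i = ∑_{j=1}^{i-1} (e_{i,j} + ē_{i,j}) - L_i`. -/
def y (d : WBC R A r t) (i : ℕ) : A := (∑ j ∈ Finset.Ico 1 i, (d.E i j + d.Eb i j)) - d.L i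

/-- `ȳ_i = ∑_{j=1}^{i-1} (e_{j,i} - ē_{j,i}) - L̄_i`. -/
def yb (d : WBC R A r t) (i : ℕ) : A := (∑ j ∈ Finset.Ico 1 i, (d.E j i - d.Eb j i)) - d.Lb i

/-- `c^α = c_1^{α_1} ⋯ c_r^{α_r}`. -/
def cpow (d : WBC R A r t) (α : Fin r → Fin 2) : A :=
  ((List.finRange r).map (fun i => d.c i ^ (α i : ℕ))).prod

/-- `c̄^β = c̄_1^{β_1} ⋯ c̄_t^{β_t}`. -/
def cbpow (d : WBC R A r t) (β : Fin t → Fin 2) : A :=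
  ((List.finRange t).map (fun j => d.cb j ^ (β j : ℕ))).prod

/-- `e^f = e_1 e_2 ⋯ e_f`. -/
def epow (d : WBC R A r t) (f : ℕ) : A :=
  ((List.range f).map (fun i => d.E (i + 1) (i + 1))).prod

/-- Generators of the subalgebra `BC_{m,m}`: the elements `e_1`, `s_1, …, s_{m-1}`,
`s̄_1, …, s̄_{m-1}`, `c_1` and `c̄_1` (interpreted as `∅` when `m = 0`). -/
def lowerGens (d : WBC R A r t) (m : ℕ) : Set A :=
  {x | (1 ≤ m ∧ x = d.e) ∨ (∃ j : ℕ, 1 ≤ j ∧ j + 1 ≤ m ∧ x = d.s j)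
    ∨ (∃ j : ℕ, 1 ≤ j ∧ j + 1 ≤ m ∧ x = d.sb j)
    ∨ (1 ≤ m ∧ x = d.cn 1) ∨ (1 ≤ m ∧ x = d.cbn 1)}

end WBC

/-- `φ` intertwines two sets of walled Brauer–Clifford data. -/
structure WBCHom {R A B : Type} [CommRing R] [Ring A] [Algebra R A] [Ring B] [Algebra R B]
    {r t : ℕ} (d : WBC R A r t) (d' : WBC R B r t) (φ : A →ₐ[R] B) : Prop where
  map_σ : ∀ w, φ (d.σ w) = d'.σ w
  map_σb : ∀ w, φ (d.σb w) = d'.σb w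
  map_c : ∀ i, φ (d.c i) = d'.c i
  map_cb : ∀ j, φ (d.cb j) = d'.cb j
  map_e : φ d.e = d'.e

/-- `A` (with the data `d`) *is* the walled Brauer–Clifford superalgebra `BC_{r,t}`:
it is initial among all algebras with such data. -/
def WBC.IsUniversal {R A : Type} [CommRing R] [Ring A] [Algebra R A] {r t : ℕ}
    (d : WBC R A r t) : Prop :=
  ∀ (B : Type) [Ring B] [Algebra R B], ∀ d' : WBC R B r t, ∃! φ : A →ₐ[R] B, WBCHom d d' φ

/-- An element of `D^f_{r,t}`: data `1 ≤ i_1 < ⋯ < i_f ≤ r` and `k ≤ j_k ≤ t`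
(all 1-based) describing `s_{f,i_f} s̄_{f,j_f} ⋯ s_{1,i_1} s̄_{1,j_1}`. -/
structure DElt (r t f : ℕ) : Type where
  a : Fin f → ℕ
  b : Fin f → ℕ
  ha_mono : StrictMono a
  ha_lb : ∀ k, 1 ≤ a k
  ha_ub : ∀ k, a k ≤ r
  hb_lb : ∀ k : Fin f, (k : ℕ) + 1 ≤ b k
  hb_ub : ∀ k, b k ≤ t

/-- The `Σ_r`-component `s_{f,i_f} ⋯ s_{1,i_1}` of the element of `D^f_{r,t}`. -/
def DElt.pr {r t f : ℕ} (x : DElt r t f) : Equiv.Perm (Fin r) :=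
  ((List.finRange f).reverse.map (fun (k : Fin f) => sIJ r ((k : ℕ) + 1) (x.a k))).prod

/-- The `Σ_t`-component `s̄_{f,j_f} ⋯ s̄_{1,j_1}` of the element of `D^f_{r,t}`. -/
def DElt.pt {r t f : ℕ} (x : DElt r t f) : Equiv.Perm (Fin t) :=
  ((List.finRange f).reverse.map (fun (k : Fin f) => sIJ t ((k : ℕ) + 1) (x.b k))).prod

/-- Index for the basis `{c^α d_1⁻¹ e^f w d_2 c̄^β}` of `BC_{r,t}`; the component
`w ∈ Σ_{r-f} × Σ_{t-f}` is a pair of permutations fixing `1, …, f` pointwise. -/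
structure BCIndex (r t : ℕ) : Type where
  α : Fin r → Fin 2
  β : Fin t → Fin 2
  f : ℕ
  hf : f ≤ min r t
  d1 : DElt r t f
  d2 : DElt r t f
  w : Equiv.Perm (Fin r)
  wb : Equiv.Perm (Fin t)
  hw : ∀ i : Fin r, (i : ℕ) < f → w i = i
  hwb : ∀ j : Fin t, (j : ℕ) < f → wb j = j

/-- The basis element `c^α d_1⁻¹ e^f w d_2 c̄^β` of Theorem 2.4. -/
def WBC.basElt {R A : Type} [CommRing R] [Ring A] [Algebra R A] {r t : ℕ}
    (d : WBC R A r t) (x : BCIndex r t) : A :=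
  d.cpow x.α * d.σ (x.d1.pr⁻¹) * d.σb (x.d1.pt⁻¹) * d.epow x.f *
    d.σ x.w * d.σb x.wb * d.σ x.d2.pr * d.σb x.d2.pt * d.cbpow x.β

/-- Data for the presentation of the affine walled Brauer–Clifford superalgebra
`BC^aff_{r,t}` (Definition 3.1) with distinguished parameter `ω_1 ∈ R`.
`om k` is `ω_k` (with `ω_1` the scalar `ω1` and `ω_{2k} = 0`), `omb k` is `ω̄_k`. -/
structure AWBC (R A : Type) [CommRing R] [Ring A] [Algebra R A] (r t : ℕ) (ω1 : R)
    extends WBC R A r t : Type where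
  x1 : A
  xb1 : A
  om : ℕ → A
  omb : ℕ → A
  om_one : om 1 = algebraMap R A ω1
  om_even : ∀ k, om (2 * k) = 0
  omb_zero : omb 0 = 0
  om_comm : ∀ k, (∀ w, om k * σ w = σ w * om k) ∧ (∀ w, om k * σb w = σb w * om k) ∧
    (∀ i, om k * c i = c i * om k) ∧ (∀ j, om k * cb j = cb j * om k) ∧
    om k * e = e * om k ∧ om k * x1 = x1 * om k ∧ om k * xb1 = xb1 * om k ∧
    (∀ l, om k * om l = om l * om k) ∧ (∀ l, om k * omb l = omb l * om k)
  omb_comm : ∀ k, (∀ w, omb k * σ w = σ w * omb k) ∧ (∀ w, omb k * σb w = σb w * omb k) ∧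
    (∀ i, omb k * c i = c i * omb k) ∧ (∀ j, omb k * cb j = cb j * omb k) ∧
    omb k * e = e * omb k ∧ omb k * x1 = x1 * omb k ∧ omb k * xb1 = xb1 * omb k ∧
    (∀ l, omb k * omb l = omb l * omb k)
  x_comm : ∀ h : 1 < r, x1 * (σ (sw r 0 1) * x1 * σ (sw r 0 1)
      - (1 - c ⟨0, by omega⟩ * c ⟨1, h⟩) * σ (sw r 0 1))
    = (σ (sw r 0 1) * x1 * σ (sw r 0 1)
      - (1 - c ⟨0, by omega⟩ * c ⟨1, h⟩) * σ (sw r 0 1)) * x1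
  x1_c1 : ∀ h : 0 < r, x1 * c ⟨0, h⟩ = -(c ⟨0, h⟩ * x1)
  x1_c : ∀ i : Fin r, (i : ℕ) ≠ 0 → x1 * c i = c i * x1
  s_x1 : ∀ i : ℕ, 0 < i → i + 1 < r → σ (sw r i (i + 1)) * x1 = x1 * σ (sw r i (i + 1))
  xb_comm : ∀ h : 1 < t, xb1 * (σb (sw t 0 1) * xb1 * σb (sw t 0 1)
      - (1 + cb ⟨0, by omega⟩ * cb ⟨1, h⟩) * σb (sw t 0 1))
    = (σb (sw t 0 1) * xb1 * σb (sw t 0 1)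
      - (1 + cb ⟨0, by omega⟩ * cb ⟨1, h⟩) * σb (sw t 0 1)) * xb1
  xb1_cb1 : ∀ h : 0 < t, xb1 * cb ⟨0, h⟩ = -(cb ⟨0, h⟩ * xb1)
  xb1_cb : ∀ j : Fin t, (j : ℕ) ≠ 0 → xb1 * cb j = cb j * xb1
  sb_xb1 : ∀ j : ℕ, 0 < j → j + 1 < t → σb (sw t j (j + 1)) * xb1 = xb1 * σb (sw t j (j + 1))
  e_xsum : e * (x1 + xb1) = 0
  xsum_e : (x1 + xb1) * e = 0
  e_sxs : 1 < r → e * (σ (sw r 0 1) * x1 * σ (sw r 0 1)) = (σ (sw r 0 1) * x1 * σ (sw r 0 1)) * e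
  x_mixed : ∀ h : 0 < r, x1 * (e + xb1 - c ⟨0, h⟩ * e * c ⟨0, h⟩)
      = (e - c ⟨0, h⟩ * e * c ⟨0, h⟩ + xb1) * x1
  e_sbxbsb : 1 < t →
    e * (σb (sw t 0 1) * xb1 * σb (sw t 0 1)) = (σb (sw t 0 1) * xb1 * σb (sw t 0 1)) * e
  e_xodd : ∀ k : ℕ, e * x1 ^ (2 * k + 1) * e = om (2 * k + 1) * e
  e_xeven : ∀ k : ℕ, 1 ≤ k → e * x1 ^ (2 * k) * e = 0
  e_xb : ∀ k : ℕ, 1 ≤ k → e * xb1 ^ k * e = omb k * e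
  x1_cb_comm : ∀ j, x1 * cb j = cb j * x1
  xb1_c_comm : ∀ i, xb1 * c i = c i * xb1
  x1_σb : ∀ w, σb w * x1 = x1 * σb w
  xb1_σ : ∀ w, σ w * xb1 = xb1 * σ w

namespace AWBC

variable {R A : Type} [CommRing R] [Ring A] [Algebra R A] {r t : ℕ} {ω1 : R}

/-- `x'_i = s_{i-1} ⋯ s_1 x_1 s_1 ⋯ s_{i-1}` (1-based). -/
def xp (d : AWBC R A r t ω1) (i : ℕ) : A :=
  ((List.range (i - 1)).reverse.map (fun k => d.toWBC.s (k + 1))).prod * d.x1 *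
    ((List.range (i - 1)).map (fun k => d.toWBC.s (k + 1))).prod

/-- `x̄'_j = s̄_{j-1} ⋯ s̄_1 x̄_1 s̄_1 ⋯ s̄_{j-1}` (1-based). -/
def xbp (d : AWBC R A r t ω1) (j : ℕ) : A :=
  ((List.range (j - 1)).reverse.map (fun k => d.toWBC.sb (k + 1))).prod * d.xb1 *
    ((List.range (j - 1)).map (fun k => d.toWBC.sb (k + 1))).prod

/-- `x_i = x'_i - L_i`. -/
def xv (d : AWBC R A r t ω1) (i : ℕ) : A := d.xp i - d.toWBC.L i

/-- `x̄_j = x̄'_j - L̄_j`. -/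
def xbv (d : AWBC R A r t ω1) (j : ℕ) : A := d.xbp j - d.toWBC.Lb j

/-- `x^α = x_1^{α_1} ⋯ x_r^{α_r}`. -/
def xpow (d : AWBC R A r t ω1) (α : Fin r → ℕ) : A :=
  ((List.finRange r).map (fun (i : Fin r) => d.xv ((i : ℕ) + 1) ^ α i)).prod

/-- `x̄^β = x̄_1^{β_1} ⋯ x̄_t^{β_t}`. -/
def xbpow (d : AWBC R A r t ω1) (β : Fin t → ℕ) : A :=
  ((List.finRange t).map (fun (j : Fin t) => d.xbv ((j : ℕ) + 1) ^ β j)).prod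

/-- `∏_{n ∈ ℤ^{>0}} ω_{2n+1}^{a_{2n+1}}`, where `g i` is the exponent of `ω_{2(i+1)+1}`. -/
def ompow (d : AWBC R A r t ω1) (g : ℕ →₀ ℕ) : A :=
  ((g.support.sort (· ≤ ·)).map (fun n => d.om (2 * n + 3) ^ g n)).prod

/-- `z_i = x'_i + y_i`. -/
def z (d : AWBC R A r t ω1) (i : ℕ) : A := d.xp i + d.toWBC.y i

/-- `z̄_j = x̄'_j + ȳ_j`. -/
def zb (d : AWBC R A r t ω1) (j : ℕ) : A := d.xbp j + d.toWBC.yb j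

/-- Generators of the subalgebra `BC_{2,m,m}`-type subalgebra:
`e_1, s_1, …, s_{m-1}, s̄_1, …, s̄_{m-1}, c_1, c̄_1, x_1, x̄_1`. -/
def lowerGensA (d : AWBC R A r t ω1) (m : ℕ) : Set A :=
  d.toWBC.lowerGens m ∪ {x | 1 ≤ m ∧ (x = d.x1 ∨ x = d.xb1)}

end AWBC

/-- `φ` intertwines two sets of affine walled Brauer–Clifford data. -/
structure AWBCHom {R A B : Type} [CommRing R] [Ring A] [Algebra R A] [Ring B] [Algebra R B]
    {r t : ℕ} {ω1 : R} (d : AWBC R A r t ω1) (d' : AWBC R B r t ω1) (φ : A →ₐ[R] B) : Prop where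
  map_σ : ∀ w, φ (d.σ w) = d'.σ w
  map_σb : ∀ w, φ (d.σb w) = d'.σb w
  map_c : ∀ i, φ (d.c i) = d'.c i
  map_cb : ∀ j, φ (d.cb j) = d'.cb j
  map_e : φ d.e = d'.e
  map_x1 : φ d.x1 = d'.x1
  map_xb1 : φ d.xb1 = d'.xb1
  map_om : ∀ k, φ (d.om k) = d'.om k
  map_omb : ∀ k, φ (d.omb k) = d'.omb k

/-- `A` (with the data `d`) is the affine walled Brauer–Clifford superalgebra
`BC^aff_{r,t}` of Definition 3.1. -/
def AWBC.IsUniversal {R A : Type} [CommRing R] [Ring A] [Algebra R A] {r t : ℕ} {ω1 : R}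
    (d : AWBC R A r t ω1) : Prop :=
  ∀ (B : Type) [Ring B] [Algebra R B], ∀ d' : AWBC R B r t ω1,
    ∃! φ : A →ₐ[R] B, AWBCHom d d' φ

/-- Assumption 3.6: the parameters `ω̄` are determined by the `ω`'s as in Corollary 3.5. -/
def AWBC.Ass36 {R A : Type} [CommRing R] [Ring A] [Algebra R A] {r t : ℕ} {ω1 : R}
    (d : AWBC R A r t ω1) : Prop :=
  (∀ n, d.omb (2 * n) = 0) ∧
  (∀ n, d.omb (2 * n + 1) = ∑ j ∈ Finset.range (n + 1), acoef d.om n j * d.om (2 * j + 1))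

/-- `A` (with the data `d`) is the affine walled Brauer–Clifford superalgebra
`BC^aff_{r,t}` subject to Assumption 3.6. -/
def AWBC.IsUniversal36 {R A : Type} [CommRing R] [Ring A] [Algebra R A] {r t : ℕ} {ω1 : R}
    (d : AWBC R A r t ω1) : Prop :=
  d.Ass36 ∧ ∀ (B : Type) [Ring B] [Algebra R B], ∀ d' : AWBC R B r t ω1,
    d'.Ass36 → ∃! φ : A →ₐ[R] B, AWBCHom d d' φ

/-- The parameters `ω_k`, `ω̄_k` are the scalars `ω k`, `obar ω k` (specialization defining
the algebra `B̃C_{r,t}` of Definition 3.13). -/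
def AWBC.IsSpec {R A : Type} [CommRing R] [Ring A] [Algebra R A] {r t : ℕ} {ω1 : R}
    (d : AWBC R A r t ω1) (ω : ℕ → R) : Prop :=
  (∀ k, d.om k = algebraMap R A (ω k)) ∧ (∀ k, 1 ≤ k → d.omb k = algebraMap R A (obar ω k))

/-- `A` (with the data `d`) is the algebra `B̃C_{r,t}` of Definition 3.13 with parameters
`ω_{2n+1} ∈ R`. -/
def AWBC.IsSpecUniversal {R A : Type} [CommRing R] [Ring A] [Algebra R A] {r t : ℕ} {ω1 : R}
    (d : AWBC R A r t ω1) (ω : ℕ → R) : Prop :=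
  d.IsSpec ω ∧ ∀ (B : Type) [Ring B] [Algebra R B], ∀ d' : AWBC R B r t ω1,
    d'.IsSpec ω → ∃! φ : A →ₐ[R] B, AWBCHom d d' φ

/-- The cyclotomic relations `f(x_1) = 0` and `g(x̄_1) = 0`. -/
def AWBC.IsCyc {R A : Type} [CommRing R] [Ring A] [Algebra R A] {r t : ℕ} {ω1 : R}
    (d : AWBC R A r t ω1) (f g : Polynomial R) : Prop :=
  Polynomial.aeval d.x1 f = 0 ∧ Polynomial.aeval d.xb1 g = 0

/-- `A` (with the data `d`) is the cyclotomic walled Brauer–Clifford superalgebra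
`BC_{ℓ,r,t}` of Definition 3.14 attached to `f`, `g` and the scalar parameters `ω`. -/
def AWBC.IsCycUniversal {R A : Type} [CommRing R] [Ring A] [Algebra R A] {r t : ℕ} {ω1 : R}
    (d : AWBC R A r t ω1) (ω : ℕ → R) (f g : Polynomial R) : Prop :=
  d.IsSpec ω ∧ d.IsCyc f g ∧ ∀ (B : Type) [Ring B] [Algebra R B], ∀ d' : AWBC R B r t ω1,
    d'.IsSpec ω → d'.IsCyc f g → ∃! φ : A →ₐ[R] B, AWBCHom d d' φ

/-- Index of a regular monomial `x^α d x̄^β ∏_{n≥1} ω_{2n+1}^{a_{2n+1}}` of `BC^aff_{r,t}`. -/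
structure ARIndex (r t : ℕ) : Type where
  α : Fin r → ℕ
  β : Fin t → ℕ
  dIdx : BCIndex r t
  g : ℕ →₀ ℕ

/-- The regular monomial `x^α d x̄^β ∏_{n≥1} ω_{2n+1}^{a_{2n+1}}` of Definition 3.11. -/
def AWBC.regElt {R A : Type} [CommRing R] [Ring A] [Algebra R A] {r t : ℕ} {ω1 : R}
    (d : AWBC R A r t ω1) (x : ARIndex r t) : A :=
  d.xpow x.α * d.toWBC.basElt x.dIdx * d.xbpow x.β * d.ompow x.g

/-- Index of a regular monomial `x^α d x̄^β` of `B̃C_{r,t}`. -/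
structure SIndex (r t : ℕ) : Type where
  α : Fin r → ℕ
  β : Fin t → ℕ
  dIdx : BCIndex r t

/-- The regular monomial `x^α d x̄^β` of `B̃C_{r,t}`. -/
def AWBC.sregElt {R A : Type} [CommRing R] [Ring A] [Algebra R A] {r t : ℕ} {ω1 : R}
    (d : AWBC R A r t ω1) (x : SIndex r t) : A :=
  d.xpow x.α * d.toWBC.basElt x.dIdx * d.xbpow x.β

/-- Index of a regular monomial `x^α d x̄^β` of the level `ℓ` algebra `BC_{ℓ,r,t}`,
with exponents in `{0, 1, …, ℓ-1}`. -/
structure CIndex (r t ℓ : ℕ) : Type where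
  α : Fin r → Fin ℓ
  β : Fin t → Fin ℓ
  dIdx : BCIndex r t

/-- The regular monomial `x^α d x̄^β` of `BC_{ℓ,r,t}`. -/
def AWBC.cregElt {R A : Type} [CommRing R] [Ring A] [Algebra R A] {r t ℓ : ℕ} {ω1 : R}
    (d : AWBC R A r t ω1) (x : CIndex r t ℓ) : A :=
  d.xpow (fun i => (x.α i : ℕ)) * d.toWBC.basElt x.dIdx * d.xbpow (fun j => (x.β j : ℕ))

/-- Admissibility (Definition 6.4): writing `f(x) = x^{k+2m} + ∑_{i=1}^{2m} a_i x^{k+2m-i}`,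
one has `ω_L = -(a_1 ω_{L-1} + ⋯ + a_{2m} ω_{L-2m})` for all `L ≥ k + 2m`. -/
def AdmissibleParam {R : Type} [CommRing R] (ω : ℕ → R) (f : Polynomial R) (k m : ℕ) : Prop :=
  ∀ L, k + 2 * m ≤ L →
    ω L = -∑ i ∈ Finset.Icc 1 (2 * m), f.coeff (k + 2 * m - i) * ω (L - i)

/-- The parameters `ω_0 = 0`, `ω_1 = -2m(2p-2m+1)`, `ω_i = p(p+1) ω_{i-2}` of (4.16). -/
def omSeq (m : ℕ) (p : ℂ) : ℕ → ℂ
  | 0 => 0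
  | 1 => -2 * (m : ℂ) * (2 * p - 2 * (m : ℂ) + 1)
  | n + 2 => p * (p + 1) * omSeq m p n

/-- Index of a monomial `d_1^{-1} c^α x'^β e^f x̄'^{β̄} c̄^{ᾱ} w d_2` of (4.20). -/
structure L2Index (r t : ℕ) : Type where
  α : Fin r → Fin 2
  βx : Fin r → Fin 2
  αb : Fin t → Fin 2
  βxb : Fin t → Fin 2
  f : ℕ
  hf : f ≤ min r t
  d1 : DElt r t f
  d2 : DElt r t f
  w : Equiv.Perm (Fin r)
  wb : Equiv.Perm (Fin t)
  hw : ∀ i : Fin r, (i : ℕ) < f → w i = i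
  hwb : ∀ j : Fin t, (j : ℕ) < f → wb j = j

/-- The monomial `d_1^{-1} c^α x'^β e^f x̄'^{β̄} c̄^{ᾱ} w d_2` of (4.20), where
`x'^β = x'_r{}^{β_r} ⋯ x'_1{}^{β_1}` and `x̄'^{β̄} = x̄'_t{}^{β̄_t} ⋯ x̄'_1{}^{β̄_1}`. -/
def AWBC.l2Elt {R A : Type} [CommRing R] [Ring A] [Algebra R A] {r t : ℕ} {ω1 : R}
    (d : AWBC R A r t ω1) (x : L2Index r t) : A :=
  d.toWBC.σ (x.d1.pr⁻¹) * d.toWBC.σb (x.d1.pt⁻¹) * d.toWBC.cpow x.α *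
    ((List.finRange r).reverse.map (fun (i : Fin r) => d.xp ((i : ℕ) + 1) ^ (x.βx i : ℕ))).prod *
    d.toWBC.epow x.f *
    ((List.finRange t).reverse.map (fun (j : Fin t) => d.xbp ((j : ℕ) + 1) ^ (x.βxb j : ℕ))).prod *
    d.toWBC.cbpow x.αb *
    d.toWBC.σ x.w * d.toWBC.σb x.wb * d.toWBC.σ x.d2.pr * d.toWBC.σb x.d2.pt

theorem ra {A : Type} [Ring A] {a b c : A} (h : a * b = c) (w : A) : a * (b * w) = c * w := by
  rw [← mul_assoc, h]

theorem ra3 {A : Type} [Ring A] {a b c d : A} (h : a * (b * c) = d) (w : A) :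
    a * (b * (c * w)) = d * w := by
  rw [← h]; simp only [mul_assoc]

/-- Local relations of the walled Brauer–Clifford algebra, indexed by arbitrary types, with a
sign `η` making the presentation symmetric under exchanging the two sides of the wall. -/
structure Loc (A I J : Type) [Ring A] : Type where
  η : A
  hη : η = 1 ∨ η = -1
  τ : I → I → A
  τb : J → J → A
  c : I → A
  cb : J → A
  E : I → J → A
  τ_symm : ∀ a b, τ a b = τ b a
  τb_symm : ∀ a b, τb a b = τb b a
  τ_sq : ∀ a b, τ a b * τ a b = 1
  τb_sq : ∀ a b, τb a b * τb a b = 1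
  τ_τ : ∀ k l a, k ≠ l → k ≠ a → l ≠ a → τ k l * τ k a = τ l a * τ k l
  τb_τb : ∀ k l a, k ≠ l → k ≠ a → l ≠ a → τb k l * τb k a = τb l a * τb k l
  τ_τ_ne : ∀ k l m a, k ≠ m → k ≠ a → l ≠ m → l ≠ a → τ k l * τ m a = τ m a * τ k l
  τb_τb_ne : ∀ k l m a, k ≠ m → k ≠ a → l ≠ m → l ≠ a → τb k l * τb m a = τb m a * τb k l
  c_sq : ∀ a, c a * c a = -η
  cb_sq : ∀ a, cb a * cb a = η
  c_anti : ∀ a b, a ≠ b → c a * c b = -(c b * c a)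
  cb_anti : ∀ a b, a ≠ b → cb a * cb b = -(cb b * cb a)
  c_cb : ∀ a j, c a * cb j = -(cb j * c a)
  τ_c : ∀ a b, τ a b * c b = c a * τ a b
  τb_cb : ∀ a b, τb a b * cb b = cb a * τb a b
  τ_c_ne : ∀ a b d, d ≠ a → d ≠ b → τ a b * c d = c d * τ a b
  τb_cb_ne : ∀ a b d, d ≠ a → d ≠ b → τb a b * cb d = cb d * τb a b
  τ_E : ∀ a b j, τ a b * E b j = E a j * τ a b
  τb_E : ∀ j l a, τb j l * E a l = E a j * τb j l
  τ_E_ne : ∀ a b d j, d ≠ a → d ≠ b → τ a b * E d j = E d j * τ a b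
  τb_E_ne : ∀ j l m a, m ≠ j → m ≠ l → τb j l * E a m = E a m * τb j l
  τ_τb : ∀ a b j l, τ a b * τb j l = τb j l * τ a b
  τ_cb : ∀ a b j, τ a b * cb j = cb j * τ a b
  τb_c : ∀ j l a, τb j l * c a = c a * τb j l
  E_c : ∀ a j, E a j * c a = E a j * cb j
  c_E : ∀ a j, c a * E a j = cb j * E a j
  c_E_ne : ∀ k a j, k ≠ a → c k * E a j = E a j * c k
  cb_E_ne : ∀ k a j, k ≠ j → cb k * E a j = E a j * cb k
  E_sq : ∀ a j, E a j * E a j = 0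
  E_c_E : ∀ a j, E a j * c a * E a j = 0
  E_τ_E : ∀ a b j, a ≠ b → E a j * τ a b * E a j = E a j
  E_τb_E : ∀ a j l, j ≠ l → E a j * τb j l * E a j = E a j
  E_E : ∀ a b j l, a ≠ b → j ≠ l → E a j * E b l = E b l * E a j

namespace Loc

variable {A I J : Type} [Ring A]

/-- Exchange the two sides of the wall. -/
def swap (d : Loc A I J) : Loc A J I where
  η := -d.η
  hη := by rcases d.hη with h | h <;> simp [h]
  τ := d.τb
  τb := d.τ
  c := d.cb
  cb := d.c
  E := fun j a => d.E a j
  τ_symm := d.τb_symm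
  τb_symm := d.τ_symm
  τ_sq := d.τb_sq
  τb_sq := d.τ_sq
  τ_τ := d.τb_τb
  τb_τb := d.τ_τ
  τ_τ_ne := d.τb_τb_ne
  τb_τb_ne := d.τ_τ_ne
  c_sq := by intro a; rw [d.cb_sq, neg_neg]
  cb_sq := d.c_sq
  c_anti := d.cb_anti
  cb_anti := d.c_anti
  c_cb := by intro a j; rw [d.c_cb, neg_neg]
  τ_c := d.τb_cb
  τb_cb := d.τ_c
  τ_c_ne := d.τb_cb_ne
  τb_cb_ne := d.τ_c_ne
  τ_E := d.τb_E
  τb_E := d.τ_E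
  τ_E_ne := d.τb_E_ne
  τb_E_ne := d.τ_E_ne
  τ_τb := by intro a b j l; rw [d.τ_τb]
  τ_cb := d.τb_c
  τb_c := d.τ_cb
  E_c := by intro a j; rw [d.E_c]
  c_E := by intro a j; rw [d.c_E]
  c_E_ne := by intro k a j h; exact d.cb_E_ne k j a h
  cb_E_ne := by intro k a j h; exact d.c_E_ne k j a h
  E_sq := by intro a j; exact d.E_sq j a
  E_c_E := by intro a j; rw [← d.E_c]; exact d.E_c_E j a
  E_τ_E := by intro a b j h; exact d.E_τb_E j a b h
  E_τb_E := by intro a b j h; exact d.E_τ_E b j a h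
  E_E := by intro a b j l h1 h2; exact d.E_E j l a b h2 h1

/-- `e + η c e c`. -/
def O (d : Loc A I J) (a : I) (j : J) : A := d.E a j + d.η * (d.c a * d.E a j * d.c a)

/-- Summand of the Jucys–Murphy element. -/
def M (d : Loc A I J) (k a : I) : A := d.τ k a + d.η * (d.c a * d.τ k a * d.c a)

/-- General version of `y`. -/
def Y (d : Loc A I J) (a : I) (S : Finset I) (S' : Finset J) : A :=
  (∑ j ∈ S', d.O a j) - ∑ k ∈ S, d.M k a

theorem comm_η (d : Loc A I J) (x : A) : Commute d.η x := by
  rcases d.hη with h | h <;> rw [h]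
  · exact Commute.one_left x
  · exact (Commute.one_left x).neg_left

theorem η_sq (d : Loc A I J) : d.η * d.η = 1 := by
  rcases d.hη with h | h <;> rw [h] <;> simp

theorem mulη (d : Loc A I J) (x y : A) : x * (d.η * y) = d.η * (x * y) := by
  rw [← mul_assoc, ← (d.comm_η x).eq, mul_assoc]

theorem cEc (d : Loc A I J) (a : I) (j : J) :
    d.c a * d.E a j * d.c a = d.cb j * d.E a j * d.cb j := by
  rw [mul_assoc, d.E_c, ← mul_assoc, d.c_E]

theorem swap_O (d : Loc A I J) (a : I) (j : J) :
    d.swap.O j a = d.E a j - d.η * (d.c a * d.E a j * d.c a) := by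
  simp only [O, swap]
  rw [d.cEc]; simp [sub_eq_add_neg]

theorem O_cb (d : Loc A I J) (a : I) (j : J) :
    d.O a j = d.E a j + d.η * (d.cb j * d.E a j * d.cb j) := by
  rw [O, d.cEc]

theorem O_anti (d : Loc A I J) (a : I) (j : J) : d.c a * d.O a j = -(d.O a j * d.c a) := by
  rcases d.hη with h | h <;>
  · have hc := d.c_sq a
    rw [h] at hc
    simp only [O, h, mul_add, add_mul, mul_assoc, hc, ra hc, one_mul, mul_one, neg_mul, mul_neg,
      neg_neg]
    abel

theorem M_anti (d : Loc A I J) (k a : I) : d.c a * d.M k a = -(d.M k a * d.c a) := by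
  rcases d.hη with h | h <;>
  · have hc := d.c_sq a
    rw [h] at hc
    simp only [M, h, mul_add, add_mul, mul_assoc, hc, ra hc, one_mul, mul_one, neg_mul, mul_neg,
      neg_neg]
    abel

theorem c_E_comm (d : Loc A I J) {k a : I} (j : J) (h : k ≠ a) : Commute (d.c k) (d.E a j) :=
  d.c_E_ne k a j h

/-- anticommuting twice. -/
theorem comm_sandwich {x c E : A} (η : A) (hη : Commute x η) (hc : x * c = -(c * x))
    (hE : Commute x E) : Commute x (E + η * (c * E * c)) := by
  refine hE.add_right (hη.mul_right ?_)
  show x * (c * E * c) = c * E * c * x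
  rw [← mul_assoc, ← mul_assoc, hc, neg_mul, neg_mul, mul_assoc c x E, hE.eq, ← mul_assoc c E x,
    mul_assoc _ x c, hc]
  simp [mul_assoc]

theorem comm_sandwich' {x c E : A} (η : A) (hη : Commute x η) (hc : Commute x c)
    (hE : Commute x E) : Commute x (E + η * (c * E * c)) :=
  hE.add_right (hη.mul_right ((hc.mul_right hE).mul_right hc))

theorem c_O (d : Loc A I J) {k a : I} (j : J) (h : k ≠ a) : Commute (d.c k) (d.O a j) :=
  comm_sandwich _ (d.comm_η _).symm (d.c_anti k a h) (d.c_E_comm j h)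

theorem cb_O (d : Loc A I J) (l : J) (a : I) (j : J) : Commute (d.cb l) (d.O a j) := by
  by_cases hl : l = j
  · subst hl
    show _ * _ = _ * _
    rw [O_cb]
    rcases d.hη with h | h <;>
    · have hc := d.cb_sq l
      rw [h] at hc
      simp only [h, mul_add, add_mul, mul_assoc, hc, ra hc, one_mul, mul_one, neg_mul, mul_neg,
        neg_neg]
      abel
  · exact comm_sandwich _ (d.comm_η _).symm (by rw [d.c_cb, neg_neg]) (d.cb_E_ne l a j hl)

theorem c_M (d : Loc A I J) {k a l : I} (hk : k ≠ a) (h : l ≠ a) : Commute (d.c l) (d.M k a) := by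
  by_cases hl : l = k
  · subst hl
    have h1 := d.τ_c l a
    have h2 := d.τ_c a l
    rw [d.τ_symm] at h2
    have h3 := d.c_anti l a hk
    show _ * _ = _ * _
    rcases d.hη with h | h <;>
    · have hc := d.c_sq a
      have hc' := d.c_sq l
      rw [h] at hc hc'
      simp only [M, h, mul_add, add_mul, mul_assoc, h1, h2, ra h1, ra h2, hc, ra hc, hc', ra hc',
        one_mul, mul_one, neg_mul, mul_neg, neg_neg, h3, ra h3]
      try abel
  · exact comm_sandwich _ (d.comm_η _).symm (d.c_anti l a h) (d.τ_c_ne k a l hl h).symm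

theorem cb_M (d : Loc A I J) (l : J) (k a : I) : Commute (d.cb l) (d.M k a) :=
  comm_sandwich _ (d.comm_η _).symm (by rw [d.c_cb, neg_neg]) (d.τ_cb k a l).symm

theorem Y_anti (d : Loc A I J) (a : I) (S : Finset I) (S' : Finset J) :
    d.c a * d.Y a S S' = -(d.Y a S S' * d.c a) := by
  simp only [Y, mul_sub, sub_mul, Finset.mul_sum, Finset.sum_mul, O_anti, M_anti,
    Finset.sum_neg_distrib]
  abel

theorem cb_Y (d : Loc A I J) (l : J) (a : I) (S : Finset I) (S' : Finset J) :
    Commute (d.cb l) (d.Y a S S') :=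
  (Commute.sum_right _ _ _ fun j _ => d.cb_O l a j).sub_right
    (Commute.sum_right _ _ _ fun k _ => d.cb_M l k a)

theorem c_Y (d : Loc A I J) {k a : I} {S : Finset I} (S' : Finset J) (ha : a ∉ S) (h : k ≠ a) :
    Commute (d.c k) (d.Y a S S') :=
  (Commute.sum_right _ _ _ fun j _ => d.c_O j h).sub_right
    (Commute.sum_right _ _ _ fun l hl => d.c_M (fun e => ha (e ▸ hl)) h)

theorem τ_O (d : Loc A I J) {k l a : I} (j : J) (h1 : a ≠ k) (h2 : a ≠ l) :
    Commute (d.τ k l) (d.O a j) :=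
  comm_sandwich' _ (d.comm_η _).symm (d.τ_c_ne k l a h1 h2) (d.τ_E_ne k l a j h1 h2)

theorem conj_sandwich {x c E E' : A} (η : A) (hη : Commute x η) (hc : Commute x c)
    (hE : x * E = E' * x) : x * (E + η * (c * E * c)) = (E' + η * (c * E' * c)) * x := by
  rw [mul_add, add_mul, hE, ← mul_assoc x, hη.eq, mul_assoc, mul_assoc η]
  congr 2
  rw [← mul_assoc, ← mul_assoc, hc.eq, mul_assoc c, hE, mul_assoc, mul_assoc, hc.eq]
  simp only [mul_assoc]

section dec
variable [DecidableEq I] [DecidableEq J]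

theorem τ_M (d : Loc A I J) {k l a m : I} (hkl : k ≠ l) (h1 : a ≠ k) (h2 : a ≠ l) (hm : m ≠ a) :
    d.τ k l * d.M m a = d.M (Equiv.swap k l m) a * d.τ k l := by
  refine conj_sandwich _ (d.comm_η _).symm (d.τ_c_ne k l a h1 h2) ?_
  by_cases hk : m = k
  · subst hk
    rw [Equiv.swap_apply_left, d.τ_τ _ _ _ hkl h1.symm h2.symm]
  by_cases hl : m = l
  · subst hl
    rw [Equiv.swap_apply_right, d.τ_symm k m, d.τ_τ _ _ _ hkl.symm h2.symm h1.symm]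
  rw [Equiv.swap_apply_of_ne_of_ne hk hl]
  exact d.τ_τ_ne _ _ _ _ (Ne.symm hk) h1.symm (Ne.symm hl) h2.symm

theorem τb_O (d : Loc A I J) {k l j : J} (a : I) :
    d.τb k l * d.O a j = d.O a (Equiv.swap k l j) * d.τb k l := by
  refine conj_sandwich _ (d.comm_η _).symm (d.τb_c k l a) ?_
  by_cases hk : j = k
  · subst hk
    rw [Equiv.swap_apply_left, d.τb_symm, d.τb_E]
  by_cases hl : j = l
  · subst hl
    rw [Equiv.swap_apply_right, d.τb_E]
  rw [Equiv.swap_apply_of_ne_of_ne hk hl, d.τb_E_ne _ _ _ _ hk hl]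

theorem sum_swap {K : Type} [DecidableEq K] {S : Finset K} {k l : K}
    (h : (k ∈ S ∧ l ∈ S) ∨ (k ∉ S ∧ l ∉ S)) (f : K → A) :
    ∑ m ∈ S, f (Equiv.swap k l m) = ∑ m ∈ S, f m := by
  refine Finset.sum_equiv (Equiv.swap k l) ?_ (fun _ _ => rfl)
  intro m
  by_cases hk : m = k
  · subst hk; rw [Equiv.swap_apply_left]; tauto
  by_cases hl : m = l
  · subst hl; rw [Equiv.swap_apply_right]; tauto
  rw [Equiv.swap_apply_of_ne_of_ne hk hl]

theorem τ_Y (d : Loc A I J) {k l a : I} {S : Finset I} (S' : Finset J) (hkl : k ≠ l)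
    (h1 : a ≠ k) (h2 : a ≠ l) (ha : a ∉ S) (h : (k ∈ S ∧ l ∈ S) ∨ (k ∉ S ∧ l ∉ S)) :
    Commute (d.τ k l) (d.Y a S S') := by
  refine (Commute.sum_right _ _ _ fun j _ => d.τ_O j h1 h2).sub_right ?_
  show _ * _ = _ * _
  rw [← sum_swap h (fun m => d.M m a), Finset.sum_mul, sum_swap h (fun m => d.M m a),
    Finset.mul_sum]
  refine Finset.sum_congr rfl fun m hm => ?_
  exact d.τ_M hkl h1 h2 (fun e => ha (e ▸ hm))

theorem τb_Y (d : Loc A I J) {k l : J} (a : I) (S : Finset I) {S' : Finset J}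
    (h : (k ∈ S' ∧ l ∈ S') ∨ (k ∉ S' ∧ l ∉ S')) :
    Commute (d.τb k l) (d.Y a S S') := by
  refine Commute.sub_right ?_ (Commute.sum_right _ _ _ fun m _ => ?_)
  · show _ * _ = _ * _
    rw [← sum_swap h (fun m => d.O a m), Finset.sum_mul, sum_swap h (fun m => d.O a m),
      Finset.mul_sum]
    exact Finset.sum_congr rfl fun m hm => d.τb_O a
  · exact comm_sandwich' _ (d.comm_η _).symm (d.τb_c k l a) (d.τ_τb _ _ _ _).symm

/-- `O a j` and `M k a` agree on the left of `E k j`. -/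
theorem O_E (d : Loc A I J) {k a : I} (j : J) (h : k ≠ a) :
    d.O a j * d.E k j = d.M k a * d.E k j := by
  have h1 := d.τ_E k a j
  have h2 := d.E_τ_E a k j h.symm
  have h3 := d.c_E_ne a k j h.symm
  have h4 := d.τ_sq k a
  have hE : d.E a j * d.E k j = d.τ k a * d.E k j := by
    have : d.E k j = d.τ k a * d.E a j * d.τ k a := by
      rw [h1, mul_assoc, h4, mul_one]
    rw [this, ← mul_assoc, ← mul_assoc, d.τ_symm k a, h2, ← mul_assoc, ← mul_assoc, d.τ_symm a k,
      h4, one_mul]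
  rw [O, M, add_mul, add_mul, hE]
  congr 1
  simp only [mul_assoc, h3]
  rw [ra hE]; simp only [mul_assoc]

theorem E_O (d : Loc A I J) {k a : I} (j : J) (h : k ≠ a) :
    d.E k j * d.O a j = d.E k j * d.M k a := by
  have h1 := d.τ_E a k j
  have h2 := d.E_τ_E a k j h.symm
  have h3 := d.c_E_ne a k j h.symm
  have h4 := d.τ_sq a k
  have hE : d.E k j * d.E a j = d.E k j * d.τ k a := by
    have : d.E k j = d.τ a k * d.E a j * d.τ a k := by
      rw [mul_assoc, ← h1, ra h4, one_mul]
    rw [this, mul_assoc, mul_assoc, ← mul_assoc (d.E a j), h2, mul_assoc, mul_assoc, d.τ_symm k a,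
      h4, mul_one]
  rw [O, M, mul_add, mul_add, hE]
  congr 1
  rw [mulη, mulη]
  simp only [mul_assoc]
  rw [← mul_assoc (d.E k j) (d.c a), ← mul_assoc (d.E k j) (d.c a), ← h3, mul_assoc, ra hE]
  simp only [mul_assoc]

theorem E_Y (d : Loc A I J) {k a : I} {j : J} {S : Finset I} {S' : Finset J} (ha : a ∉ S)
    (hka : k ≠ a) (h : (k ∈ S ∧ j ∈ S') ∨ (k ∉ S ∧ j ∉ S')) :
    Commute (d.E k j) (d.Y a S S') := by
  have hO : ∀ l, l ≠ j → Commute (d.E k j) (d.O a l) := fun l hl =>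
    comm_sandwich' _ (d.comm_η _).symm (d.c_E_comm j hka.symm).symm
      (d.E_E k a j l hka (Ne.symm hl))
  have hM : ∀ m ∈ S, m ≠ k → Commute (d.E k j) (d.M m a) := fun m _ hk =>
    comm_sandwich' _ (d.comm_η _).symm (d.c_E_comm j hka.symm).symm
      (d.τ_E_ne m a k j (Ne.symm hk) hka).symm
  rcases h with ⟨h1, h2⟩ | ⟨h1, h2⟩
  · have : d.Y a S S' = (∑ l ∈ S'.erase j, d.O a l - ∑ m ∈ S.erase k, d.M m a)
        + (d.O a j - d.M k a) := by
      rw [Y, ← Finset.add_sum_erase _ _ h2, ← Finset.add_sum_erase _ _ h1]; abel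
    rw [this]
    refine Commute.add_right (Commute.sub_right ?_ ?_) ?_
    · exact Commute.sum_right _ _ _ fun l hl => hO l (Finset.ne_of_mem_erase hl)
    · exact Commute.sum_right _ _ _ fun m hm => hM m (Finset.mem_of_mem_erase hm)
        (Finset.ne_of_mem_erase hm)
    · show _ * _ = _ * _
      rw [mul_sub, sub_mul, d.E_O j hka, d.O_E j hka, sub_self, sub_self]
  · exact (Commute.sum_right _ _ _ fun l hl => hO l (fun e => h2 (e ▸ hl))).sub_right
      (Commute.sum_right _ _ _ fun m hm => hM m hm (fun e => h1 (e ▸ hm)))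

theorem M_Y (d : Loc A I J) {k l a : I} {S : Finset I} (S' : Finset J) (hkl : k ≠ l)
    (h1 : a ≠ k) (h2 : a ≠ l) (ha : a ∉ S) (h : (k ∈ S ∧ l ∈ S) ∨ (k ∉ S ∧ l ∉ S)) :
    Commute (d.M k l) (d.Y a S S') :=
  (comm_sandwich' _ (d.comm_η _).symm (d.c_Y S' ha h2.symm).symm
    (d.τ_Y S' hkl h1 h2 ha h).symm).symm

theorem O_Y (d : Loc A I J) {k a : I} {j : J} {S : Finset I} {S' : Finset J} (ha : a ∉ S)
    (hka : k ≠ a) (h : (k ∈ S ∧ j ∈ S') ∨ (k ∉ S ∧ j ∉ S')) :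
    Commute (d.O k j) (d.Y a S S') :=
  (comm_sandwich' _ (d.comm_η _).symm (d.c_Y S' ha hka).symm (d.E_Y ha hka h).symm).symm

theorem Y_Y (d : Loc A I J) {k a : I} {S T : Finset I} {S' T' : Finset J} (ha : a ∉ S)
    (hk : k ∈ S) (hT : T ⊆ S) (hT' : T' ⊆ S') (hkT : k ∉ T) :
    Commute (d.Y k T T') (d.Y a S S') := by
  have hka : k ≠ a := fun e => ha (e ▸ hk)
  refine Commute.sub_left ?_ ?_
  · exact Commute.sum_left _ _ _ fun j hj => d.O_Y ha hka (Or.inl ⟨hk, hT' hj⟩)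
  · exact Commute.sum_left _ _ _ fun m hm => d.M_Y S' (fun e => hkT (e ▸ hm))
      (fun e => ha (e ▸ hT hm)) hka.symm ha (Or.inl ⟨hT hm, hk⟩)

theorem swapY_Y (d : Loc A I J) {j : J} {a : I} {S T : Finset I} {S' T' : Finset J} (ha : a ∉ S)
    (hj : j ∈ S') (hT : T ⊆ S) (hT' : T' ⊆ S') :
    Commute (d.swap.Y j T' T) (d.Y a S S') := by
  refine Commute.sub_left ?_ ?_
  · refine Commute.sum_left _ _ _ fun k hk => ?_
    exact (comm_sandwich' (x := d.Y a S S') _ (d.swap.comm_η _).symm (d.cb_Y _ _ _ _).symm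
      (d.E_Y ha (fun e => ha (e ▸ hT hk)) (Or.inl ⟨hT hk, hj⟩)).symm).symm
  · refine Commute.sum_left _ _ _ fun k hk => ?_
    exact (comm_sandwich' (x := d.Y a S S') _ (d.swap.comm_η _).symm (d.cb_Y _ _ _ _).symm
      (d.τb_Y _ _ (Or.inl ⟨hT' hk, hj⟩)).symm).symm

end dec

/-- (8), one summand. -/
theorem E_O8 (d : Loc A I J) (a : I) {b j : J} (h : j ≠ b) :
    d.E a b * d.O a j = d.E a b * d.swap.M j b := by
  have h1 := d.τb_E b j a
  have h2 := d.E_τb_E a b j h.symm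
  have h4 := d.τb_sq b j
  have hE : d.E a j = d.τb b j * d.E a b * d.τb b j := by
    rw [mul_assoc, ← h1, ra h4, one_mul]
  have h5 : d.E a b * d.E a j = d.E a b * d.τb b j := by
    rw [hE, ← mul_assoc, ← mul_assoc, h2]
  rw [O_cb]
  simp only [M, swap]
  rw [mul_add, mul_add, h5, d.τb_symm j b]
  congr 1
  rw [neg_mul, mul_neg, mulη, mulη, ← mul_neg]
  congr 1
  have h6 := d.cb_E_ne j a b h
  have h7 := d.cb_anti b j h.symm
  have h8 := d.τb_cb b j
  have h9 := d.τb_cb j b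
  rw [d.τb_symm j b] at h9
  rw [mul_assoc (d.cb b), h9, ← mul_assoc (d.cb b), h7, mul_assoc (d.cb j), ← mul_assoc (d.E a b),
    ← h6, mul_assoc, ← mul_assoc (d.E a b) (d.E a j), h5, mul_assoc, h8, neg_mul, mul_neg, neg_neg,
    mul_assoc (d.cb j), ← mul_assoc (d.E a b) (d.cb j), ← h6, mul_assoc]

theorem O_E8 (d : Loc A I J) (a : I) {b j : J} (h : j ≠ b) :
    d.O a j * d.E a b = d.swap.M j b * d.E a b := by
  have h1 := d.τb_E j b a
  have h2 := d.E_τb_E a b j h.symm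
  have h4 := d.τb_sq b j
  have hE : d.E a j = d.τb b j * d.E a b * d.τb b j := by
    rw [d.τb_symm b j, h1, mul_assoc, d.τb_symm j b, h4, mul_one]
  have h5 : d.E a j * d.E a b = d.τb b j * d.E a b := by
    rw [hE, mul_assoc, mul_assoc, ← mul_assoc (d.E a b), h2]
  rw [O_cb]
  simp only [M, swap]
  rw [add_mul, add_mul, h5, d.τb_symm j b]
  congr 1
  rw [mul_assoc, mul_assoc (-d.η), neg_mul, ← mul_neg]
  congr 1
  have h6 := d.cb_E_ne j a b h
  have h7 := d.cb_anti b j h.symm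
  have h8 := d.τb_cb b j
  have h9 := d.τb_cb j b
  rw [d.τb_symm j b] at h9
  simp only [mul_assoc]
  rw [h6, ra h5, ra h9]
  rw [← mul_assoc (d.cb b) (d.cb j * d.τb b j), ← mul_assoc (d.cb b) (d.cb j), h7]
  simp only [mul_assoc, neg_mul, neg_neg]
  rw [← h6, ra h8]
  simp only [mul_assoc]

end Loc
section RingSteps
variable {B : Type} [Ring B]

theorem tw {b u v G H : B} (h : b * u = v * b) (hG : u * G = 1) (hH : H * v = 1) :
    b * G = H * b := by
  calc b * G = (H * v) * b * G := by rw [hH, one_mul]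
    _ = H * (b * u) * G := by rw [h]; simp only [mul_assoc]
    _ = H * b * (u * G) := by simp only [mul_assoc]
    _ = H * b := by rw [hG, mul_one]

theorem ring_step1 (z e s c1 c2 η x1 x2 G1 G2 Gh : B)
    (hz : ∀ b, Commute z b) (hη : ∀ b, Commute η b) (hη2 : η * η = 1) (hs : s * s = 1)
    (hG1 : (1 - x1) * G1 = 1) (hG1' : G1 * (1 - x1) = 1)
    (hG2 : (1 - x2) * G2 = 1) (hG2' : G2 * (1 - x2) = 1)
    (hGh : (1 + x1) * Gh = 1) (hGh' : Gh * (1 + x1) = 1)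
    (hsx : s * x1 = x2 * s + z * (1 - η * (c1 * c2)))
    (h12 : Commute x1 x2) (hx1e : Commute x1 e) (hc1e : Commute c1 e) (hc1x2 : Commute c1 x2)
    (hc2x1 : Commute c2 x1) (hc1x1 : c1 * x1 = -(x1 * c1)) (hc12 : c2 * c1 = -(c1 * c2))
    (hc1 : c1 * c1 = -η) (hsc2 : s * c2 = c1 * s) (hc2s : c2 * s = s * c1)
    (hese : e * s * e = e) (h0 : e * (s * G1 * s) * c2 * e = 0) :
    Commute G1 (e * G2 * c2 * e) ∧ Commute Gh (e * G2 * c2 * e) ∧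
    e * G2 * c2 * e = z * (z * (G1 * (e * G2 * c2 * e) * G1 + Gh * (e * G2 * c2 * e) * Gh)) := by
  have cm : ∀ {b x G : B}, Commute b x → (1 - x) * G = 1 → G * (1 - x) = 1 → Commute G b := by
    intro b x G h h1 h2
    exact (tw (by rw [mul_sub, sub_mul, h.eq, mul_one, one_mul]) h1 h2 : b * G = G * b).symm
  have cm' : ∀ {b x G : B}, Commute b x → (1 + x) * G = 1 → G * (1 + x) = 1 → Commute G b := by
    intro b x G h h1 h2
    exact (tw (by rw [mul_add, add_mul, h.eq, mul_one, one_mul]) h1 h2 : b * G = G * b).symm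
  have g1e := cm hx1e.symm hG1 hG1'
  have g1x2 := cm h12.symm hG1 hG1'
  have g12 : Commute G1 G2 := (cm g1x2 hG2 hG2').symm
  have ghe := cm' hx1e.symm hGh hGh'
  have ghx2 := cm' h12.symm hGh hGh'
  have gh2 : Commute Gh G2 := (cm ghx2 hG2 hG2').symm
  have g1c2 := cm hc2x1 hG1 hG1'
  have ghc2 := cm' hc2x1 hGh hGh'
  have g2c1 := cm hc1x2 hG2 hG2'
  have g1h : Commute G1 Gh :=
    (cm' (cm (Commute.refl x1) hG1 hG1') hGh hGh').symm
  have cg1 : c1 * G1 = Gh * c1 := tw (by rw [mul_sub, add_mul, hc1x1, mul_one, one_mul]; abel) hG1 hGh'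
  have cgh : c1 * Gh = G1 * c1 := tw (by rw [mul_add, sub_mul, hc1x1, mul_one, one_mul]; abel) hGh hG1'
  have sG : s * G1 = G2 * s + z * (G2 * (1 - η * (c1 * c2)) * G1) := by
    have : s * (1 - x1) = (1 - x2) * s - z * (1 - η * (c1 * c2)) := by
      rw [mul_sub, hsx, sub_mul, mul_one, one_mul]; abel
    have h3 : G2 * (s * (1 - x1)) * G1 = G2 * ((1 - x2) * s - z * (1 - η * (c1 * c2))) * G1 := by
      rw [this]
    rw [mul_assoc, mul_assoc, hG1, mul_one, mul_sub, ← mul_assoc, hG2', one_mul, sub_mul,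
      ← mul_assoc G2, ← (hz G2).eq, mul_assoc z, mul_assoc z] at h3
    rw [h3]; abel
  obtain ⟨T, hT⟩ : ∃ T, T = e * G2 * c2 * e := ⟨_, rfl⟩
  obtain ⟨W, hW⟩ : ∃ W, W = e * G2 * e := ⟨_, rfl⟩
  obtain ⟨V, hV⟩ : ∃ V, V = e * G2 * s * e := ⟨_, rfl⟩
  have T1 : Commute G1 T := by
    rw [hT]; exact ((g1e.mul_right g12).mul_right g1c2).mul_right g1e
  have Th : Commute Gh T := by
    rw [hT]; exact ((ghe.mul_right gh2).mul_right ghc2).mul_right ghe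
  have W1 : Commute G1 W := by
    rw [hW]; exact (g1e.mul_right g12).mul_right g1e
  have Wh : Commute Gh W := by
    rw [hW]; exact (ghe.mul_right gh2).mul_right ghe
  have Wc : Commute c1 W := by
    rw [hW]; exact (hc1e.mul_right g2c1.symm).mul_right hc1e
  have Tc : c1 * T = -(T * c1) := by
    rw [hT]
    calc c1 * (e * G2 * c2 * e) = (c1 * (e * G2)) * c2 * e := by simp only [mul_assoc]
      _ = (e * G2) * (c1 * c2) * e := by
        rw [(hc1e.mul_right g2c1.symm).eq]; simp only [mul_assoc]
      _ = -((e * G2) * c2 * (c1 * e)) := by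
        rw [← neg_eq_iff_eq_neg.mpr hc12]; simp only [mul_assoc, mul_neg, neg_mul]
      _ = _ := by rw [hc1e.eq]; simp only [mul_assoc]
  have V1 : V = (e - z * W + z * (η * (c1 * T))) * G1 := by
    have h3 : e * (s * G1) * e = e * (G2 * s + z * (G2 * (1 - η * (c1 * c2)) * G1)) * e := by rw [sG]
    have h4 : e * (s * G1) * e = e * G1 := by
      rw [← mul_assoc, mul_assoc, g1e.eq, ← mul_assoc, hese]
    have h5 : e * (z * (G2 * (1 - η * (c1 * c2)) * G1)) * e = z * ((W - η * (c1 * T)) * G1) := by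
      have : c1 * T = e * G2 * (c1 * c2) * e := by
        rw [hT]
        calc _ = (c1 * (e * G2)) * c2 * e := by simp only [mul_assoc]
          _ = _ := by rw [(hc1e.mul_right g2c1.symm).eq]; simp only [mul_assoc]
      rw [this, hW, ← mul_assoc e z, ← (hz e).eq, mul_assoc, mul_assoc]
      congr 1
      rw [mul_assoc e, mul_assoc _ G1, g1e.eq, ← mul_assoc, ← mul_assoc]
      congr 1
      simp only [mul_sub, sub_mul, mul_one, mul_assoc]
      congr 1
      rw [← mul_assoc G2 η, ← (hη G2).eq, mul_assoc η, ← mul_assoc e η, ← (hη e).eq, mul_assoc]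
    rw [mul_add, add_mul, h4, h5, ← mul_assoc, ← hV] at h3
    rw [eq_sub_of_add_eq h3.symm]
    noncomm_ring
  have T2 : T = -(z * (G1 * c1 * V - Gh * V * c1)) := by
    have h3 : e * (s * G1 * s) * c2 * e =
      T + z * (e * G2 * (1 - η * (c1 * c2)) * G1 * (s * c2 * e)) := by
      rw [sG, hT, add_mul, mul_assoc G2, hs, mul_one, mul_add, add_mul, add_mul, ← mul_assoc e,
        ← mul_assoc e, ← (hz e).eq]
      simp only [mul_assoc]
    have h4 : e * G2 * (1 - η * (c1 * c2)) * G1 * (s * c2 * e)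
        = e * G2 * (G1 * c1) * (s * e) - e * G2 * (η * (c1 * c2)) * G1 * c1 * s * e := by
      rw [hsc2, mul_sub]; noncomm_ring
    have h5 : e * G2 * (G1 * c1) * (s * e) = G1 * c1 * V := by
      rw [hV, mul_assoc _ (G1 * c1), ← mul_assoc (G1 * c1)]
      have : Commute (G1 * c1) (e * G2) := (g1e.mul_right g12).mul_left (hc1e.mul_right g2c1.symm)
      rw [← mul_assoc, ← mul_assoc, ← this.eq]; simp only [mul_assoc]
    have h6 : e * G2 * (η * (c1 * c2)) * G1 * c1 * s * e = Gh * V * c1 := by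
      calc e * G2 * (η * (c1 * c2)) * G1 * c1 * s * e
          = e * G2 * η * c1 * (c2 * G1) * c1 * s * e := by simp only [mul_assoc]
        _ = e * G2 * η * (c1 * G1) * (c2 * c1) * s * e := by
          rw [← g1c2.eq]; simp only [mul_assoc]
        _ = -(e * G2 * η * Gh * (c1 * c1) * (c2 * s) * e) := by
          rw [cg1, hc12]; simp only [mul_assoc, mul_neg, neg_mul]
        _ = e * G2 * (η * (Gh * η)) * (s * (c1 * e)) := by
          rw [hc1, hc2s]; simp only [mul_assoc, mul_neg, neg_mul, neg_neg]
        _ = (e * G2) * Gh * s * (e * c1) := by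
          rw [← (hη Gh).eq, ← mul_assoc η, hη2, one_mul, hc1e.eq]; simp only [mul_assoc]
        _ = Gh * V * c1 := by
          rw [← (ghe.mul_right gh2).eq, hV]; simp only [mul_assoc]
    rw [h0, h4, h5, h6] at h3
    exact eq_neg_of_add_eq_zero_left h3.symm
  rw [← hT]
  refine ⟨T1, Th, ?_⟩
  obtain ⟨Q, hQ⟩ : ∃ Q, Q = e - z * W := ⟨_, rfl⟩
  have Q1 : Commute G1 Q := by
    rw [hQ]; exact g1e.sub_right ((hz G1).symm.mul_right W1)
  have Qh : Commute Gh Q := by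
    rw [hQ]; exact ghe.sub_right ((hz Gh).symm.mul_right Wh)
  have Qc : Commute c1 Q := by
    rw [hQ]; exact hc1e.sub_right ((hz c1).symm.mul_right Wc)
  rw [← hQ] at V1
  have a1 : G1 * c1 * (Q * G1) = Gh * (Q * G1) * c1 := by
    calc G1 * c1 * (Q * G1) = G1 * (c1 * Q) * G1 := by simp only [mul_assoc]
      _ = G1 * Q * (c1 * G1) := by rw [Qc.eq]; simp only [mul_assoc]
      _ = Q * (G1 * Gh) * c1 := by rw [cg1, Q1.eq]; simp only [mul_assoc]
      _ = (Q * Gh) * G1 * c1 := by rw [g1h.eq]; simp only [mul_assoc]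
      _ = _ := by rw [← Qh.eq]; simp only [mul_assoc]
  have a2 : G1 * c1 * (z * (η * (c1 * T)) * G1) = -(z * (G1 * T * G1)) := by
    calc G1 * c1 * (z * (η * (c1 * T)) * G1) = z * (G1 * c1 * (η * c1) * T * G1) := by
          rw [mul_assoc z, ← mul_assoc _ z, ← (hz _).eq]; simp only [mul_assoc]
      _ = z * (G1 * (c1 * c1) * η * T * G1) := by rw [(hη c1).eq]; simp only [mul_assoc]
      _ = -(z * (G1 * (η * η) * T * G1)) := by
        rw [hc1]; simp only [mul_assoc, neg_mul, mul_neg]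
      _ = _ := by rw [hη2, mul_one]
  have a3 : Gh * (z * (η * (c1 * T)) * G1) * c1 = z * (Gh * T * Gh) := by
    have b : G1 * c1 = c1 * Gh := cgh.symm
    calc Gh * (z * (η * (c1 * T)) * G1) * c1 = z * (Gh * η * (c1 * T) * (G1 * c1)) := by
          rw [mul_assoc z, ← mul_assoc _ z, ← (hz _).eq]; simp only [mul_assoc]
      _ = -(z * (Gh * η * T * (c1 * c1) * Gh)) := by
          rw [b, Tc]; simp only [mul_assoc, neg_mul, mul_neg]
      _ = z * (Gh * η * (T * η) * Gh) := by
          rw [hc1]; simp only [mul_assoc, neg_mul, mul_neg, neg_neg]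
      _ = z * (Gh * (η * η) * T * Gh) := by rw [← (hη T).eq]; simp only [mul_assoc]
      _ = _ := by rw [hη2, mul_one]
  conv_lhs => rw [T2, V1]
  rw [add_mul, mul_add, mul_add, add_mul, a1, a2, a3]
  noncomm_ring

theorem ring_step2 (z e f c cb η x y w G H K Kh Gh : B)
    (hz : ∀ b, Commute z b) (hη : ∀ b, Commute η b) (hη2 : η * η = 1)
    (hG : (1 - y) * G = 1) (hG' : G * (1 - y) = 1)
    (hH : (1 - x) * H = 1) (hH' : H * (1 - x) = 1)
    (hGh : (1 + y) * Gh = 1) (hGh' : Gh * (1 + y) = 1)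
    (hK : (1 + w) * K = 1) (hK' : K * (1 + w) = 1)
    (hKh : (1 - w) * Kh = 1) (hKh' : Kh * (1 - w) = 1)
    (hy : y = x + z * (f + η * (c * f * c)))
    (fy : f * y = -(f * w)) (yf : y * f = -(w * f))
    (wy : Commute w y) (we : Commute w e) (wc : Commute w c) (wcb : cb * w = -(w * cb))
    (cy : c * y = -(y * c)) (cbx : Commute cb x) (hc : c * c = -η)
    (fc : f * c = f * cb) (cf : c * f = cb * f) (cbe : Commute cb e)
    (efe : e * f * e = e) (hfH : f * c * H * f = 0) (eff : e * (f * H * f) * e = e * H * e)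
    (wW : Commute w (e * H * e)) :
    e * G * c * e = e * H * c * e := by
  have cm : ∀ {b x G : B}, Commute b x → (1 - x) * G = 1 → G * (1 - x) = 1 → Commute G b := by
    intro b x G h h1 h2
    exact (tw (by rw [mul_sub, sub_mul, h.eq, mul_one, one_mul]) h1 h2 : b * G = G * b).symm
  have cm' : ∀ {b x G : B}, Commute b x → (1 + x) * G = 1 → G * (1 + x) = 1 → Commute G b := by
    intro b x G h h1 h2
    exact (tw (by rw [mul_add, add_mul, h.eq, mul_one, one_mul]) h1 h2 : b * G = G * b).symm
  have Ke : Commute K e := cm' we.symm hK hK'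
  have Khe : Commute Kh e := cm we.symm hKh hKh'
  have Kc : Commute K c := cm' wc.symm hK hK'
  have Hcb : Commute H cb := cm cbx hH hH'
  have Gw : Commute G w := cm wy hG hG'
  have Ghw : Commute Gh w := cm' wy hGh hGh'
  have fG : f * G = f * K := by
    have h1 : f * (1 - y) = f * (1 + w) := by rw [mul_sub, mul_add, fy]; abel
    have h2 : f = f * G * (1 + w) := by
      calc f = f * (1 - y) * G := by rw [mul_assoc, hG, mul_one]
        _ = f * ((1 + w) * G) := by rw [h1, mul_assoc]
        _ = f * (G * (1 + w)) := by rw [add_mul 1 w G, mul_add G 1 w, Gw.eq, mul_one, one_mul]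
        _ = _ := by rw [mul_assoc]
    conv_rhs => rw [h2, mul_assoc, hK, mul_one]
  have fGh : f * Gh = f * Kh := by
    have h1 : f * (1 + y) = f * (1 - w) := by rw [mul_sub, mul_add, fy]; abel
    have h2 : f = f * Gh * (1 - w) := by
      calc f = f * (1 + y) * Gh := by rw [mul_assoc, hGh, mul_one]
        _ = f * ((1 - w) * Gh) := by rw [h1, mul_assoc]
        _ = f * (Gh * (1 - w)) := by rw [sub_mul 1 w Gh, mul_sub Gh 1 w, Ghw.eq, mul_one, one_mul]
        _ = _ := by rw [mul_assoc]
    conv_rhs => rw [h2, mul_assoc, hKh, mul_one]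
  have Gf : G * f = K * f := by
    have h1 : (1 - y) * f = (1 + w) * f := by rw [sub_mul, add_mul, yf]; abel
    have h2 : f = (1 + w) * (G * f) := by
      calc f = G * ((1 - y) * f) := by rw [← mul_assoc, hG', one_mul]
        _ = (G * (1 + w)) * f := by rw [h1, mul_assoc]
        _ = ((1 + w) * G) * f := by rw [add_mul 1 w, mul_add, Gw.eq, mul_one, one_mul]
        _ = _ := by rw [mul_assoc]
    conv_rhs => rw [h2, ← mul_assoc, hK', one_mul]
  have cG : c * G = Gh * c :=
    tw (by rw [mul_sub, add_mul, cy, mul_one, one_mul]; abel) hG hGh'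
  have cbK : cb * K = Kh * cb :=
    tw (by rw [mul_add, sub_mul, wcb, mul_one, one_mul]; abel) hK hKh'
  have cbKh : cb * Kh = K * cb :=
    tw (by rw [mul_sub, add_mul, wcb, mul_one, one_mul]; abel) hKh hK'
  obtain ⟨o, ho⟩ : ∃ o, o = f + η * (c * f * c) := ⟨_, rfl⟩
  rw [← ho] at hy
  have GH : G = H + z * (H * o * G) := by
    have : H * ((1 - x) - (1 - y)) * G = H * (z * o) * G := by rw [hy]; congr 2; abel
    rw [mul_sub, hH', sub_mul, one_mul, mul_assoc H (1 - y), hG, mul_one, ← mul_assoc H z,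
      ← (hz H).eq] at this
    rw [show z * (H * o * G) = G - H from by rw [this]; simp only [mul_assoc]]; abel
  have HG : H = G - z * (G * o * H) := by
    have : G * ((1 - x) - (1 - y)) * H = G * (z * o) * H := by rw [hy]; congr 2; abel
    rw [mul_sub, hG', sub_mul, one_mul, mul_assoc G (1 - x), hH, mul_one, ← mul_assoc G z,
      ← (hz G).eq] at this
    simp only [mul_assoc] at this ⊢
    rw [← this]; abel
  obtain ⟨V, hV⟩ : ∃ V, V = e * H * f * e := ⟨_, rfl⟩
  obtain ⟨W, hW⟩ : ∃ W, W = e * H * e := ⟨_, rfl⟩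
  have V1 : V = K * (e - z * W) := by
    have h1 : V = e * (G * f) * e - z * (e * (G * f) * (H * f) * e)
        - z * (e * G * (η * c) * (f * c * H * f) * e) := by
      rw [hV]
      conv_lhs => rw [HG]
      rw [mul_sub, sub_mul, sub_mul, ← mul_assoc e z, ← (hz e).eq, ho]
      noncomm_ring
    rw [h1, hfH, Gf]
    have h2 : e * (K * f) * e = K * e := by
      rw [← mul_assoc, ← Ke.eq, mul_assoc, mul_assoc, ← mul_assoc e, efe]
    have h3 : e * (K * f) * (H * f) * e = K * W := by
      rw [hW, ← eff, ← mul_assoc e, ← Ke.eq]; simp only [mul_assoc]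
    rw [h2, h3, ← mul_assoc z, (hz K).eq]; noncomm_ring
  have h5 : e * H * o * G * c * e = V * cb * K - cb * V * Kh := by
    have h6 : e * H * f * G * c * e = V * cb * K := by
      calc e * H * f * G * c * e = e * H * (f * G) * c * e := by simp only [mul_assoc]
        _ = e * H * f * (K * c) * e := by rw [fG]; simp only [mul_assoc]
        _ = e * H * (f * c) * (K * e) := by rw [Kc.eq]; simp only [mul_assoc]
        _ = e * H * f * (cb * e) * K := by rw [fc, Ke.eq]; simp only [mul_assoc]
        _ = _ := by rw [cbe.eq, hV]; simp only [mul_assoc]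
    have h7 : e * H * (η * (c * f * c)) * G * c * e = -(cb * V * Kh) := by
      calc e * H * (η * (c * f * c)) * G * c * e
          = e * H * η * (c * f) * (c * G) * c * e := by simp only [mul_assoc]
        _ = e * H * η * cb * (f * Gh) * (c * c) * e := by rw [cf, cG]; simp only [mul_assoc]
        _ = -(e * H * η * cb * f * Kh * η * e) := by
          rw [fGh, hc]; simp only [mul_assoc, mul_neg, neg_mul]
        _ = -(e * H * (η * (cb * f * Kh * η)) * e) := by simp only [mul_assoc]
        _ = -(e * (H * cb) * f * (Kh * e)) := by
          rw [← (hη (cb * f * Kh)).eq, ← mul_assoc η, hη2, one_mul]; simp only [mul_assoc]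
        _ = -((e * cb) * H * f * e * Kh) := by
          rw [Hcb.eq, Khe.eq]; simp only [mul_assoc]
        _ = _ := by rw [← cbe.eq, hV]; simp only [mul_assoc]
    rw [ho, mul_add, add_mul, add_mul, add_mul, h6, h7, sub_eq_add_neg]
  obtain ⟨Q, hQ⟩ : ∃ Q, Q = e - z * W := ⟨_, rfl⟩
  have wQ : Commute w Q := by
    rw [hQ, hW]; exact we.sub_right ((hz w).symm.mul_right wW)
  have KQ : Commute K Q := cm' wQ.symm hK hK'
  have KhQ : Commute Kh Q := cm wQ.symm hKh hKh'
  have KKh : Commute K Kh := cm' (cm (Commute.refl w) hKh hKh') hK hK'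
  have cbQ : Commute cb Q := by
    rw [hQ, hW]
    exact cbe.sub_right ((hz cb).symm.mul_right ((cbe.mul_right Hcb.symm).mul_right cbe))
  have h8 : V * cb * K = cb * V * Kh := by
    rw [V1, ← hQ]
    calc K * Q * cb * K = K * Q * (cb * K) := by simp only [mul_assoc]
      _ = K * (Q * Kh) * cb := by rw [cbK]; simp only [mul_assoc]
      _ = (K * Kh) * Q * cb := by rw [← KhQ.eq]; simp only [mul_assoc]
      _ = Kh * (K * Q) * cb := by rw [KKh.eq]; simp only [mul_assoc]
      _ = Kh * Q * (K * cb) := by rw [KQ.eq]; simp only [mul_assoc]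
      _ = Kh * (Q * cb) * Kh := by rw [← cbKh]; simp only [mul_assoc]
      _ = (Kh * cb) * Q * Kh := by rw [← cbQ.eq]; simp only [mul_assoc]
      _ = _ := by rw [← cbK]; simp only [mul_assoc]
  rw [h8, sub_self] at h5
  have h9 : e * G * c * e = e * H * c * e + z * (e * H * o * G * c * e) := by
    conv_lhs => rw [GH]
    rw [mul_add, add_mul, add_mul, ← mul_assoc e z, ← (hz e).eq]
    simp only [mul_assoc]
  rw [h9, h5, mul_zero, add_zero]

end RingSteps
section PowSteps

variable {A : Type} [Ring A]

/-- The geometric series. -/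
def geo (x : A) : PowerSeries A := PowerSeries.mk (fun k => x ^ k)

theorem geo_left (x : A) : (1 - PowerSeries.X * PowerSeries.C x) * geo x = 1 := by
  ext n
  rw [sub_mul, one_mul, map_sub, mul_assoc]
  cases n with
  | zero => simp [geo]
  | succ n => simp [geo, PowerSeries.coeff_succ_X_mul, PowerSeries.coeff_C_mul, PowerSeries.coeff_one, pow_succ']

theorem geo_right (x : A) : geo x * (1 - PowerSeries.X * PowerSeries.C x) = 1 := by
  ext n
  rw [mul_sub, mul_one, map_sub, PowerSeries.X_mul, ← mul_assoc]
  cases n with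
  | zero => simp [geo]
  | succ n => simp [geo, PowerSeries.coeff_succ_mul_X, PowerSeries.coeff_mul_C, PowerSeries.coeff_one, pow_succ]

theorem geo_neg_left (x : A) : (1 + PowerSeries.X * PowerSeries.C x) * geo (-x) = 1 := by
  have := geo_left (-x)
  rwa [map_neg, mul_neg, sub_neg_eq_add] at this

theorem geo_neg_right (x : A) : geo (-x) * (1 + PowerSeries.X * PowerSeries.C x) = 1 := by
  have := geo_right (-x)
  rwa [map_neg, mul_neg, sub_neg_eq_add] at this

theorem XC_comm {x y : A} (h : Commute x y) : Commute (PowerSeries.X * PowerSeries.C x : PowerSeries A) (PowerSeries.X * PowerSeries.C y) := by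
  have h1 : ∀ f : PowerSeries A, Commute PowerSeries.X f := fun f => (PowerSeries.commute_X f).symm
  have h2 : Commute (PowerSeries.C x : PowerSeries A) (PowerSeries.C y) := by
    show _ * _ = _ * _
    rw [← map_mul, h.eq, map_mul]
  exact ((h1 PowerSeries.X).mul_left (h1 _).symm).mul_right ((h1 _).mul_left h2)

theorem XC_comm' {x y : A} (h : Commute x y) : Commute (PowerSeries.X * PowerSeries.C x : PowerSeries A) (PowerSeries.C y) := by
  have h1 : ∀ f : PowerSeries A, Commute PowerSeries.X f := fun f => (PowerSeries.commute_X f).symm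
  have h2 : Commute (PowerSeries.C x : PowerSeries A) (PowerSeries.C y) := by
    show _ * _ = _ * _
    rw [← map_mul, h.eq, map_mul]
  exact ((h1 _).mul_left h2)

theorem X_all (f : PowerSeries A) : Commute (PowerSeries.X : PowerSeries A) f := (PowerSeries.commute_X f).symm

theorem C_all {η : A} (h : ∀ b, Commute η b) (f : PowerSeries A) :
    Commute (PowerSeries.C η : PowerSeries A) f := by
  show _ * _ = _ * _
  ext n
  rw [PowerSeries.coeff_C_mul, PowerSeries.coeff_mul_C, (h _).eq]

theorem pow_step1 (e s c1 c2 η x1 x2 : A)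
    (hη : ∀ b, Commute η b) (hη2 : η * η = 1) (hs : s * s = 1)
    (hsx : s * x1 = x2 * s + (1 - η * (c1 * c2)))
    (h12 : Commute x1 x2) (hx1e : Commute x1 e) (hc1e : Commute c1 e) (hc1x2 : Commute c1 x2)
    (hc2x1 : Commute c2 x1) (hc1x1 : c1 * x1 = -(x1 * c1)) (hc12 : c2 * c1 = -(c1 * c2))
    (hc1 : c1 * c1 = -η) (hsc2 : s * c2 = c1 * s) (hc2s : c2 * s = s * c1)
    (hese : e * s * e = e) (h0 : ∀ n : ℕ, e * (s * x1 ^ n * s) * c2 * e = 0) (n : ℕ) :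
    e * x2 ^ n * c2 * e = 0 := by
  have key := ring_step1 (PowerSeries.X : PowerSeries A) (PowerSeries.C e) (PowerSeries.C s) (PowerSeries.C c1) (PowerSeries.C c2) (PowerSeries.C η) (PowerSeries.X * PowerSeries.C x1) (PowerSeries.X * PowerSeries.C x2)
    (geo x1) (geo x2) (geo (-x1)) X_all (C_all hη) (by rw [← map_mul, hη2, map_one])
    (by rw [← map_mul, hs, map_one]) (geo_left x1) (geo_right x1) (geo_left x2) (geo_right x2)
    (geo_neg_left x1) (geo_neg_right x1)
    (by
      rw [← mul_assoc, ← (X_all (PowerSeries.C s)).eq, mul_assoc, mul_assoc, ← mul_add]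
      congr 1
      rw [← map_mul, hsx]
      simp only [map_add, map_sub, map_mul, map_one])
    (XC_comm h12) (XC_comm' hx1e)
    (by show _ * _ = _ * _; rw [← map_mul, hc1e.eq, map_mul]) (XC_comm' hc1x2.symm).symm
    (XC_comm' hc2x1.symm).symm
    (by rw [← mul_assoc, ← (X_all (PowerSeries.C c1)).eq, mul_assoc, mul_assoc, ← map_mul, ← map_mul, hc1x1,
      map_neg, mul_neg])
    (by rw [← map_mul, ← map_mul, hc12, map_neg]) (by rw [← map_mul, hc1, map_neg])
    (by rw [← map_mul, ← map_mul, hsc2]) (by rw [← map_mul, ← map_mul, hc2s])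
    (by rw [← map_mul, ← map_mul, hese])
    (by
      ext n
      rw [PowerSeries.coeff_mul_C, PowerSeries.coeff_mul_C, PowerSeries.coeff_C_mul, PowerSeries.coeff_mul_C, PowerSeries.coeff_C_mul, geo, PowerSeries.coeff_mk, h0]
      simp)
  obtain ⟨_, _, hT⟩ := key
  obtain ⟨T, hTd⟩ : ∃ T, T = PowerSeries.C e * geo x2 * PowerSeries.C c2 * PowerSeries.C e := ⟨_, rfl⟩
  rw [← hTd] at hT
  have hz : ∀ n, PowerSeries.coeff n T = 0 := by
    intro n
    induction n using Nat.strong_induction_on with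
    | _ n ih =>
      have h3 : ∀ g : PowerSeries A, ∀ m < n, PowerSeries.coeff m (g * T * g) = 0 := by
        intro g m hm
        rw [PowerSeries.coeff_mul]
        apply Finset.sum_eq_zero
        rintro ⟨i, j⟩ hij
        rw [Finset.HasAntidiagonal.mem_antidiagonal] at hij
        simp only at hij ⊢
        rw [PowerSeries.coeff_mul, Finset.sum_eq_zero, zero_mul]
        rintro ⟨i', j'⟩ hij'
        rw [Finset.HasAntidiagonal.mem_antidiagonal] at hij'
        simp only at hij' ⊢
        rw [ih j' (by omega), mul_zero]
      rw [hT]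
      match n with
      | 0 => simp
      | 1 => rw [PowerSeries.coeff_succ_X_mul]; simp
      | m + 2 =>
        rw [PowerSeries.coeff_succ_X_mul, PowerSeries.coeff_succ_X_mul, map_add, h3 _ m (by omega), h3 _ m (by omega),
          add_zero]
  have := hz n
  rwa [hTd, PowerSeries.coeff_mul_C, PowerSeries.coeff_mul_C, PowerSeries.coeff_C_mul, geo, PowerSeries.coeff_mk] at this

theorem pow_step2 (e f c cb η x y w : A)
    (hη : ∀ b, Commute η b) (hη2 : η * η = 1)
    (hy : y = x + (f + η * (c * f * c)))
    (fy : f * y = -(f * w)) (yf : y * f = -(w * f))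
    (wy : Commute w y) (we : Commute w e) (wc : Commute w c) (wcb : cb * w = -(w * cb))
    (cy : c * y = -(y * c)) (cbx : Commute cb x) (hc : c * c = -η)
    (fc : f * c = f * cb) (cf : c * f = cb * f) (cbe : Commute cb e)
    (efe : e * f * e = e) (hfH : ∀ n : ℕ, f * c * x ^ n * f = 0)
    (eff : ∀ n : ℕ, e * (f * x ^ n * f) * e = e * x ^ n * e)
    (wW : ∀ n : ℕ, Commute w (e * x ^ n * e)) (n : ℕ) :
    e * y ^ n * c * e = e * x ^ n * c * e := by
  have sC : ∀ a b : A, PowerSeries.C a * (PowerSeries.X * PowerSeries.C b) = PowerSeries.X * PowerSeries.C (a * b) := by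
    intro a b
    rw [← mul_assoc, ← (X_all (PowerSeries.C a)).eq, mul_assoc, map_mul]
  have Cs : ∀ a b : A, (PowerSeries.X * PowerSeries.C a) * PowerSeries.C b = PowerSeries.X * PowerSeries.C (a * b) := by
    intro a b
    rw [mul_assoc, map_mul]
  have key := ring_step2 (PowerSeries.X : PowerSeries A) (PowerSeries.C e) (PowerSeries.C f) (PowerSeries.C c) (PowerSeries.C cb) (PowerSeries.C η) (PowerSeries.X * PowerSeries.C x) (PowerSeries.X * PowerSeries.C y)
    (PowerSeries.X * PowerSeries.C w) (geo y) (geo x) (geo (-w)) (geo w) (geo (-y)) X_all (C_all hη)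
    (by rw [← map_mul, hη2, map_one]) (geo_left y) (geo_right y) (geo_left x) (geo_right x)
    (geo_neg_left y) (geo_neg_right y) (geo_neg_left w) (geo_neg_right w) (geo_left w)
    (geo_right w)
    (by
      rw [← mul_add]
      congr 1
      rw [hy]
      simp only [map_add, map_mul])
    (by rw [sC, sC, fy, map_neg, mul_neg]) (by rw [Cs, Cs, yf, map_neg, mul_neg])
    (XC_comm wy) (XC_comm' we) (XC_comm' wc) (by rw [sC, Cs, wcb, map_neg, mul_neg])
    (by rw [sC, Cs, cy, map_neg, mul_neg]) (XC_comm' cbx.symm).symm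
    (by rw [← map_mul, hc, map_neg]) (by rw [← map_mul, ← map_mul, fc])
    (by rw [← map_mul, ← map_mul, cf]) (by show _ * _ = _ * _; rw [← map_mul, cbe.eq, map_mul])
    (by rw [← map_mul, ← map_mul, efe])
    (by
      ext n
      rw [← map_mul, PowerSeries.coeff_mul_C, PowerSeries.coeff_C_mul, geo, PowerSeries.coeff_mk, hfH]
      simp)
    (by
      ext n
      simp only [PowerSeries.coeff_mul_C, PowerSeries.coeff_C_mul, geo, PowerSeries.coeff_mk]
      rw [eff])
    (by
      apply (X_all _).mul_left
      show _ * _ = _ * _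
      ext n
      simp only [PowerSeries.coeff_mul_C, PowerSeries.coeff_C_mul, geo, PowerSeries.coeff_mk]
      rw [(wW n).eq])
  have := congrArg (PowerSeries.coeff n) key
  simpa only [PowerSeries.coeff_mul_C, PowerSeries.coeff_C_mul, geo, PowerSeries.coeff_mk] using this

end PowSteps
namespace Loc
variable {A I J : Type} [Ring A]

theorem swap_swap (d : Loc A I J) : d.swap.swap = d := by
  cases d; simp [swap]

theorem E_Ej (d : Loc A I J) (a : I) {b j : J} (h : j ≠ b) :
    d.E a b * d.E a j = d.E a b * d.τb b j := by
  have hE : d.E a j = d.τb b j * d.E a b * d.τb b j := by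
    rw [mul_assoc, ← d.τb_E b j a, ra (d.τb_sq b j), one_mul]
  rw [hE, ← mul_assoc, ← mul_assoc, d.E_τb_E a b j h.symm]

theorem Ej_E (d : Loc A I J) (a : I) {b j : J} (h : j ≠ b) :
    d.E a j * d.E a b = d.τb b j * d.E a b := by
  have hE : d.E a j = d.τb b j * d.E a b * d.τb b j := by
    rw [mul_assoc, ← d.τb_E b j a, ra (d.τb_sq b j), one_mul]
  rw [hE]
  calc _ = d.τb b j * (d.E a b * d.τb b j * d.E a b) := by simp only [mul_assoc]
    _ = _ := by rw [d.E_τb_E a b j h.symm]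

theorem E_M8 (d : Loc A I J) {a k : I} (b : J) (h : k ≠ a) :
    d.E a b * d.M k a = d.E a b * d.swap.O b k := by
  have := d.swap.E_O8 b h
  rw [swap_swap] at this
  exact this.symm

theorem M_E8 (d : Loc A I J) {a k : I} (b : J) (h : k ≠ a) :
    d.M k a * d.E a b = d.swap.O b k * d.E a b := by
  have := d.swap.O_E8 b h
  rw [swap_swap] at this
  exact this.symm

theorem E_Y8 (d : Loc A I J) {a : I} {b : J} {S : Finset I} {S' : Finset J} (ha : a ∉ S)
    (hb : b ∉ S') : d.E a b * d.Y a S S' = -(d.E a b * d.swap.Y b S' S) := by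
  simp only [Y, mul_sub, Finset.mul_sum]
  rw [Finset.sum_congr rfl fun j hj => d.E_O8 a (b := b) (j := j) (fun e => hb (e ▸ hj)),
    Finset.sum_congr rfl fun k hk => d.E_M8 (a := a) (k := k) b (fun e => ha (e ▸ hk))]
  rw [neg_sub]

theorem Y_E8 (d : Loc A I J) {a : I} {b : J} {S : Finset I} {S' : Finset J} (ha : a ∉ S)
    (hb : b ∉ S') : d.Y a S S' * d.E a b = -(d.swap.Y b S' S * d.E a b) := by
  simp only [Y, sub_mul, Finset.sum_mul]
  rw [Finset.sum_congr rfl fun j hj => d.O_E8 a (b := b) (j := j) (fun e => hb (e ▸ hj)),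
    Finset.sum_congr rfl fun k hk => d.M_E8 (a := a) (k := k) b (fun e => ha (e ▸ hk))]
  rw [neg_sub]

theorem c_c_pow {c y : A} (h : c * y = -(y * c)) (n : ℕ) : c * y ^ n = (-1) ^ n * (y ^ n * c) := by
  induction n with
  | zero => simp
  | succ n ih =>
    rw [pow_succ, ← mul_assoc, ih, mul_assoc, mul_assoc, h, pow_succ (-1 : A)]
    simp only [mul_assoc, mul_neg, neg_mul, one_mul]

section dec
variable [DecidableEq I] [DecidableEq J]

theorem Y_insert (d : Loc A I J) {k : I} (a : I) {S : Finset I} (S' : Finset J) (hk : k ∉ S) :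
    d.Y a (insert k S) S' = d.Y a S S' - d.M k a := by
  rw [Y, Y, Finset.sum_insert hk]; abel

theorem Y_insert' (d : Loc A I J) {j : J} (a : I) (S : Finset I) {S' : Finset J} (hj : j ∉ S') :
    d.Y a S (insert j S') = d.Y a S S' + d.O a j := by
  rw [Y, Y, Finset.sum_insert hj]; abel

theorem conj2 {x c c' E E' : A} (η : A) (hη : Commute x η) (hc : x * c = c' * x)
    (hE : x * E = E' * x) : x * (E + η * (c * E * c)) = (E' + η * (c' * E' * c')) * x := by
  rw [mul_add, add_mul, hE, ← mul_assoc x, hη.eq, mul_assoc, mul_assoc η]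
  congr 2
  rw [← mul_assoc, ← mul_assoc, hc, mul_assoc c', hE, mul_assoc, mul_assoc, hc]
  simp only [mul_assoc]

/-- Transporting `Y k` to `Y a`. -/
theorem τ_Y_conj (d : Loc A I J) {k a : I} {S : Finset I} (S' : Finset J) (hka : k ≠ a)
    (hk : k ∉ S) (ha : a ∉ S) : d.τ k a * d.Y k S S' = d.Y a S S' * d.τ k a := by
  have hc : d.τ k a * d.c k = d.c a * d.τ k a := by rw [d.τ_symm, d.τ_c]
  rw [Y, Y, mul_sub, sub_mul, Finset.mul_sum, Finset.mul_sum, Finset.sum_mul, Finset.sum_mul]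
  congr 1
  · refine Finset.sum_congr rfl fun j _ => conj2 _ (d.comm_η _).symm hc ?_
    rw [d.τ_symm, d.τ_E]
  · refine Finset.sum_congr rfl fun m hm => conj2 _ (d.comm_η _).symm hc ?_
    rw [d.τ_symm m k, d.τ_τ k a m hka (fun e => hk (e ▸ hm)) (fun e => ha (e ▸ hm)),
      d.τ_symm a m]

theorem M_τ (d : Loc A I J) {k a : I} (hka : k ≠ a) :
    d.M k a * d.τ k a = 1 - d.η * (d.c k * d.c a) := by
  have hc : d.c a * d.τ k a = d.τ k a * d.c k := by
    rw [d.τ_symm, d.τ_c]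
  rw [M, add_mul, d.τ_sq, sub_eq_add_neg]
  congr 1
  have h3 : d.c a * d.τ k a * d.c a * d.τ k a = d.c a * d.c k := by
    rw [mul_assoc, hc, ← mul_assoc, ← hc, mul_assoc (d.c a), d.τ_sq, mul_one]
  rw [mul_assoc, h3, ← mul_neg, d.c_anti a k hka.symm]

theorem bub_step1 (d : Loc A I J) {k : I} {S : Finset I} {S' : Finset J} (hk : k ∉ S)
    (ih : ∀ a b, a ∉ S → b ∉ S' → ∀ n : ℕ, d.E a b * d.Y a S S' ^ n * d.c a * d.E a b = 0)
    (a : I) (b : J) (ha : a ∉ insert k S) (hb : b ∉ S') (n : ℕ) :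
    d.E a b * d.Y a (insert k S) S' ^ n * d.c a * d.E a b = 0 := by
  have hka : k ≠ a := fun e => ha (e ▸ Finset.mem_insert_self k S)
  have haS : a ∉ S := fun e => ha (Finset.mem_insert_of_mem e)
  have hconj := d.τ_Y_conj S' hka hk haS
  have hsc2 : d.τ k a * d.c a = d.c k * d.τ k a := d.τ_c k a
  have hc2s : d.c a * d.τ k a = d.τ k a * d.c k := by rw [d.τ_symm, d.τ_c]
  have hτE : d.τ k a * d.E a b = d.E k b * d.τ k a := d.τ_E k a b
  have hEτ : d.E a b * d.τ k a = d.τ k a * d.E k b := by rw [d.τ_symm, d.τ_E]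
  refine pow_step1 (d.E a b) (d.τ k a) (d.c k) (d.c a) d.η (d.Y k S S') (d.Y a (insert k S) S')
    d.comm_η d.η_sq (d.τ_sq k a) ?_ ?_ ?_ ?_ ?_ ?_ (d.Y_anti k S S') (d.c_anti a k hka.symm)
    (d.c_sq k) hsc2 hc2s ?_ ?_ n
  · rw [hconj, d.Y_insert a S' hk, sub_mul, d.M_τ hka]; abel
  · exact d.Y_Y ha (Finset.mem_insert_self k S) (Finset.subset_insert k S) (Finset.Subset.refl _) hk
  · exact (d.E_Y hk hka.symm (Or.inr ⟨haS, hb⟩)).symm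
  · exact d.c_E_comm b hka
  · exact d.c_Y S' ha hka
  · exact d.c_Y S' hk hka.symm
  · rw [d.τ_symm]; exact d.E_τ_E a k b hka.symm
  · intro m
    calc d.E a b * (d.τ k a * d.Y k S S' ^ m * d.τ k a) * d.c a * d.E a b
        = (d.E a b * d.τ k a) * d.Y k S S' ^ m * (d.τ k a * d.c a) * d.E a b := by
          simp only [mul_assoc]
      _ = d.τ k a * d.E k b * d.Y k S S' ^ m * d.c k * (d.τ k a * d.E a b) := by
          rw [hEτ, hsc2]; simp only [mul_assoc]
      _ = d.τ k a * (d.E k b * d.Y k S S' ^ m * d.c k * d.E k b) * d.τ k a := by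
          rw [hτE]; simp only [mul_assoc]
      _ = 0 := by rw [ih k b hk hb, mul_zero, zero_mul]

theorem bub_step2 (d : Loc A I J) {j : J} {S : Finset I} {S' : Finset J} (hj : j ∉ S')
    (ih : ∀ a b, a ∉ S → b ∉ S' → ∀ n : ℕ, d.E a b * d.Y a S S' ^ n * d.c a * d.E a b = 0)
    (a : I) (b : J) (ha : a ∉ S) (hb : b ∉ insert j S') (n : ℕ) :
    d.E a b * d.Y a S (insert j S') ^ n * d.c a * d.E a b = 0 := by
  have hjb : j ≠ b := fun e => hb (e ▸ Finset.mem_insert_self j S')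
  have hbS : b ∉ S' := fun e => hb (Finset.mem_insert_of_mem e)
  have hfO : d.E a j * d.O a j = 0 := by
    rw [O, mul_add, d.E_sq, mulη, ← mul_assoc (d.E a j), ← mul_assoc (d.E a j), d.E_c_E]; simp
  have hOf : d.O a j * d.E a j = 0 := by
    rw [O, add_mul, d.E_sq, mul_assoc, mul_assoc, mul_assoc, ← mul_assoc (d.E a j), d.E_c_E]; simp
  have hcb : Commute (d.cb j) (d.E a b) := d.cb_E_ne j a b hjb
  have hτY : Commute (d.τb b j) (d.Y a S S') := d.τb_Y a S (Or.inr ⟨hbS, hj⟩)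
  rw [← ih a b ha hbS n]
  refine pow_step2 (d.E a b) (d.E a j) (d.c a) (d.cb j) d.η (d.Y a S S') (d.Y a S (insert j S'))
    (d.swap.Y j S' S) d.comm_η d.η_sq (d.Y_insert' a S hj) ?_ ?_ ?_ ?_ ?_ ?_ (d.Y_anti a _ _)
    (d.cb_Y j a _ _) (d.c_sq a) (d.E_c a j) (d.c_E a j) hcb ?_ ?_ ?_ ?_ n
  · rw [d.Y_insert' a S hj, mul_add, hfO, add_zero, d.E_Y8 ha hj]
  · rw [d.Y_insert' a S hj, add_mul, hOf, add_zero, d.Y_E8 ha hj]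
  · exact d.swapY_Y ha (Finset.mem_insert_self j S') (Finset.Subset.refl _)
      (Finset.subset_insert j S')
  · exact (d.swap.E_Y hj hjb.symm (Or.inr ⟨hbS, ha⟩)).symm
  · exact (d.swap.cb_Y a j S' S).symm
  · exact d.swap.Y_anti j S' S
  · rw [d.E_Ej a hjb, d.E_τb_E a b j hjb.symm]
  · intro m
    rw [mul_assoc (d.E a j), c_c_pow (d.Y_anti a S S')]
    have h1 : Commute ((-1 : A) ^ m) (d.E a j) := (Commute.neg_one_left _).pow_left m
    rw [← mul_assoc, ← h1.eq, mul_assoc, mul_assoc, ← mul_assoc (d.E a j), ← mul_assoc (d.E a j),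
      ih a j ha hj, mul_zero]
  · intro m
    calc d.E a b * (d.E a j * d.Y a S S' ^ m * d.E a j) * d.E a b
        = (d.E a b * d.E a j) * d.Y a S S' ^ m * (d.E a j * d.E a b) := by simp only [mul_assoc]
      _ = d.E a b * (d.τb b j * d.Y a S S' ^ m) * (d.τb b j * d.E a b) := by
        rw [d.E_Ej a hjb, d.Ej_E a hjb]; simp only [mul_assoc]
      _ = d.E a b * d.Y a S S' ^ m * (d.τb b j * d.τb b j) * d.E a b := by
        rw [(hτY.pow_right m).eq]; simp only [mul_assoc]
      _ = _ := by rw [d.τb_sq, mul_one]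
  · intro m
    obtain ⟨v, hv⟩ : ∃ v, v = d.swap.Y j (insert b S') (insert a S) := ⟨_, rfl⟩
    have hv1 : d.swap.Y j S' S = v - (d.swap.O j a - d.swap.M b j) := by
      rw [hv, d.swap.Y_insert _ _ hbS, d.swap.Y_insert' _ _ ha]; abel
    have hjb' : j ∉ insert b S' := by
      rw [Finset.mem_insert]; tauto
    have hvE : Commute v (d.E a b) := by
      rw [hv]
      exact (d.swap.E_Y (k := b) (j := a) hjb' hjb.symm
        (Or.inl ⟨Finset.mem_insert_self _ _, Finset.mem_insert_self _ _⟩)).symm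
    have hvY : Commute v (d.Y a S S') := by
      rw [hv]
      have := d.swap.swapY_Y (j := a) (a := j) (S := insert b S') (T := S') (S' := insert a S)
        (T' := S) hjb' (Finset.mem_insert_self _ _) (Finset.subset_insert _ _)
        (Finset.subset_insert _ _)
      rw [swap_swap] at this
      exact this.symm
    have h1 : (d.swap.O j a - d.swap.M b j) * d.E a b = 0 := by
      rw [sub_mul]; exact sub_eq_zero.mpr (d.swap.O_E a hjb.symm)
    have h2 : d.E a b * (d.swap.O j a - d.swap.M b j) = 0 := by
      rw [mul_sub]; exact sub_eq_zero.mpr (d.swap.E_O a hjb.symm)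
    have h3 := ((hvE.mul_right (hvY.pow_right m)).mul_right hvE).eq
    show _ * _ = _ * _
    rw [hv1, sub_mul, mul_sub, h3]
    rw [mul_assoc (d.E a b * d.Y a S S' ^ m) (d.E a b) (d.swap.O j a - _), h2, mul_assoc (d.E a b),
      ← mul_assoc _ (d.E a b), h1, zero_mul, mul_zero]

theorem bubble (d : Loc A I J) (S' : Finset J) : ∀ (S : Finset I) (a : I) (b : J), a ∉ S → b ∉ S' →
    ∀ n : ℕ, d.E a b * d.Y a S S' ^ n * d.c a * d.E a b = 0 := by
  induction S' using Finset.induction_on with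
  | empty =>
    intro S
    induction S using Finset.induction_on with
    | empty =>
      intro a b _ _ n
      cases n with
      | zero => simp [d.E_c_E]
      | succ n => simp [Y]
    | insert k S hk ih =>
      intro a b ha hb n
      exact d.bub_step1 hk ih a b ha hb n
  | insert j S' hj ih =>
    intro S a b ha hb n
    exact d.bub_step2 hj (ih S) a b ha hb n

theorem even_bubble (d : Loc A I J) (h2 : IsUnit (2 : A)) {S : Finset I} {S' : Finset J} {a : I}
    {b : J} (n : ℕ) : d.E a b * d.Y a S S' ^ (2 * n) * d.E a b = 0 := by
  have h1 : d.E a b * d.c a * d.Y a S S' ^ (2 * n) * (d.c a * d.E a b)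
      = -d.η * (d.E a b * d.Y a S S' ^ (2 * n) * d.E a b) := by
    rw [mul_assoc (d.E a b), c_c_pow (d.Y_anti a S S'), pow_mul]
    simp only [even_two, Even.neg_pow, one_pow, one_mul]
    calc _ = d.E a b * d.Y a S S' ^ (2 * n) * (d.c a * d.c a) * d.E a b := by
          simp only [mul_assoc, pow_mul]
      _ = _ := by
        rw [d.c_sq, mul_neg, ← (d.comm_η _).eq]; simp only [mul_assoc, neg_mul]
  have h3 : d.E a b * d.c a * d.Y a S S' ^ (2 * n) * (d.c a * d.E a b)
      = d.η * (d.E a b * d.Y a S S' ^ (2 * n) * d.E a b) := by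
    rw [d.E_c, d.c_E, mul_assoc (d.E a b), ((d.cb_Y b a S S').pow_right (2 * n)).eq]
    calc _ = d.E a b * d.Y a S S' ^ (2 * n) * (d.cb b * d.cb b) * d.E a b := by
          simp only [mul_assoc]
      _ = _ := by
        rw [d.cb_sq, ← (d.comm_η _).eq]; simp only [mul_assoc]
  have h4 := h1.symm.trans h3
  obtain ⟨q, hq⟩ : ∃ q, q = d.E a b * d.Y a S S' ^ (2 * n) * d.E a b := ⟨_, rfl⟩
  rw [← hq] at h4 ⊢
  have h5 : (2 : A) * (d.η * q) = 0 := by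
    rw [two_mul]; nth_rw 1 [← h4]; rw [neg_mul, neg_add_cancel]
  have h6 : d.η * q = 0 := h2.mul_right_eq_zero.mp h5
  calc q = d.η * (d.η * q) := by rw [← mul_assoc, d.η_sq, one_mul]
    _ = 0 := by rw [h6, mul_zero]

theorem E_M_E (d : Loc A I J) {a k : I} (b : J) (h : k ≠ a) :
    d.E a b * d.M k a * d.E a b = 2 * d.E a b := by
  have hE : d.E a b * d.τ k a * d.E a b = d.E a b := by rw [d.τ_symm]; exact d.E_τ_E a k b h.symm
  have hk : Commute (d.c k) (d.E a b) := d.c_E_comm b h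
  have hc : d.c a * d.τ k a = d.τ k a * d.c k := by rw [d.τ_symm, d.τ_c]
  rw [M, mul_add, add_mul, hE, two_mul]
  congr 1
  rw [mulη, mul_assoc]
  have h3 : d.E a b * (d.c a * d.τ k a * d.c a) * d.E a b = d.η * d.E a b := by
    calc _ = d.E a b * (d.cb b * d.τ k a * d.cb b) * d.E a b := by
            rw [mul_assoc, mul_assoc (d.c a * d.τ k a), d.c_E, ← mul_assoc, ← mul_assoc,
              ← mul_assoc, d.E_c]; simp only [mul_assoc]
      _ = d.E a b * d.τ k a * (d.cb b * d.cb b) * d.E a b := by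
            rw [← d.τ_cb]; simp only [mul_assoc]
      _ = _ := by rw [d.cb_sq, ← (d.comm_η _).eq, mul_assoc, hE]
  rw [h3, ← mul_assoc, d.η_sq, one_mul]

theorem one_bubble (d : Loc A I J) {S : Finset I} {S' : Finset J} {a : I} {b : J} (ha : a ∉ S)
    (hb : b ∉ S') (h : S.card = S'.card) : d.E a b * d.Y a S S' * d.E a b = 0 := by
  rw [Y, mul_sub, sub_mul, Finset.mul_sum, Finset.mul_sum, Finset.sum_mul, Finset.sum_mul,
    Finset.sum_congr rfl fun k hk => d.E_M_E (a := a) (k := k) b (fun e => ha (e ▸ hk)),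
    Finset.sum_congr rfl fun j hj => (show d.E a b * d.O a j * d.E a b = 2 * d.E a b by
      have hjb : j ≠ b := fun e => hb (e ▸ hj)
      rw [d.E_O8 a hjb]; exact d.swap.E_M_E a hjb)]
  rw [Finset.sum_const, Finset.sum_const, h, sub_self]

end dec
end Loc
section Perms
variable {A : Type} [Ring A] {n : ℕ}

theorem sw_eq {a b : ℕ} (ha : a < n) (hb : b < n) : sw n a b = Equiv.swap ⟨a, ha⟩ ⟨b, hb⟩ := by
  rw [sw, dif_pos ⟨ha, hb⟩]

theorem fix_swap (σ : Equiv.Perm (Fin n) →* A) (e : A)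
    (h : ∀ i : ℕ, 0 < i → i + 1 < n → σ (sw n i (i + 1)) * e = e * σ (sw n i (i + 1)))
    (g : ℕ) : ∀ i : ℕ, 0 < i → i + g < n → Commute (σ (sw n i (i + g))) e := by
  induction g with
  | zero =>
    intro i hi hn
    have h1 : sw n i (i + 0) = 1 := by
      rw [sw_eq (by omega) (by omega)]
      exact Equiv.swap_self _
    rw [h1, map_one]
    exact Commute.one_left e
  | succ g ih =>
    intro i hi hn
    by_cases hg : g = 0
    · subst hg; exact h i hi hn
    have h1 := ih i hi (by omega)
    have h2 : Commute (σ (sw n (i + g) (i + g + 1))) e := h (i + g) (by omega) (by omega)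
    have h3 : sw n i (i + (g + 1))
        = sw n (i + g) (i + g + 1) * sw n i (i + g) * sw n (i + g) (i + g + 1) := by
      rw [sw_eq (by omega) (by omega), sw_eq (by omega) (by omega), sw_eq (by omega) (by omega),
        Equiv.swap_mul_swap_mul_swap (by simp; omega) (by simp; omega), Equiv.swap_comm]
      rfl
    rw [h3, map_mul, map_mul]
    exact (h2.mul_left h1).mul_left h2

theorem fix_comm (hn : 0 < n) (σ : Equiv.Perm (Fin n) →* A) (e : A)
    (h : ∀ i : ℕ, 0 < i → i + 1 < n → σ (sw n i (i + 1)) * e = e * σ (sw n i (i + 1)))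
    (w : Equiv.Perm (Fin n)) (hw : w ⟨0, hn⟩ = ⟨0, hn⟩) : Commute (σ w) e := by
  have hsw : ∀ a b : Fin n, a ≠ ⟨0, hn⟩ → b ≠ ⟨0, hn⟩ → Commute (σ (Equiv.swap a b)) e := by
    intro a b ha hb
    have ha' : 0 < (a : ℕ) := by
      rcases Nat.eq_zero_or_pos (a : ℕ) with h0 | h0
      · exact absurd (Fin.ext h0) ha
      · exact h0
    have hb' : 0 < (b : ℕ) := by
      rcases Nat.eq_zero_or_pos (b : ℕ) with h0 | h0
      · exact absurd (Fin.ext h0) hb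
      · exact h0
    rcases le_total (a : ℕ) b with hab | hab
    · have := fix_swap σ e h (b - a) a ha' (by omega)
      rw [Nat.add_sub_cancel' hab, sw_eq a.2 b.2] at this
      exact this
    · have := fix_swap σ e h (a - b) b hb' (by omega)
      rw [Nat.add_sub_cancel' hab, sw_eq b.2 a.2, Equiv.swap_comm] at this
      exact this
  have hw' : ∀ x, w x ≠ ⟨0, hn⟩ ↔ x ≠ ⟨0, hn⟩ := by
    intro x
    rw [not_iff_not]
    constructor
    · intro hx; exact w.injective (hx.trans hw.symm)
    · intro hx; rw [hx, hw]
  have key : ∀ u : Equiv.Perm {x : Fin n // x ≠ ⟨0, hn⟩},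
      Commute (σ (Equiv.Perm.ofSubtype u)) e := by
    intro u
    induction u using Equiv.Perm.swap_induction_on with
    | one => simp
    | swap_mul f x y hxy ih =>
      rw [map_mul, map_mul, Equiv.Perm.ofSubtype_swap_eq]
      exact (hsw x y x.2 y.2).mul_left ih
  have := key (w.subtypePerm hw')
  rwa [Equiv.Perm.ofSubtype_subtypePerm] at this
  intro x hx hx0
  apply hx
  rw [hx0, hw]

theorem two_trans {z o a b : Fin n} (hzo : z ≠ o) (hab : a ≠ b) :
    ∃ w : Equiv.Perm (Fin n), w z = a ∧ w o = b := by
  refine ⟨Equiv.swap (Equiv.swap z a o) b * Equiv.swap z a, ?_, ?_⟩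
  · rw [Equiv.Perm.mul_apply, Equiv.swap_apply_left]
    refine Equiv.swap_apply_of_ne_of_ne ?_ hab
    intro h
    have : Equiv.swap z a z = Equiv.swap z a o := by rw [Equiv.swap_apply_left]; exact h
    exact hzo ((Equiv.swap z a).injective this)
  · rw [Equiv.Perm.mul_apply, Equiv.swap_apply_left]

end Perms

namespace WBC
variable {R A : Type} [CommRing R] [Ring A] [Algebra R A] {r t : ℕ}

/-- Zero-based version of `e_{i,j}`. -/
def F (d : WBC R A r t) (hr : 0 < r) (ht : 0 < t) (a : Fin r) (j : Fin t) : A :=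
  d.σb (Equiv.swap ⟨0, ht⟩ j) * d.σ (Equiv.swap ⟨0, hr⟩ a) * d.e *
    d.σ (Equiv.swap ⟨0, hr⟩ a) * d.σb (Equiv.swap ⟨0, ht⟩ j)

theorem σ_inv (d : WBC R A r t) (w : Equiv.Perm (Fin r)) : d.σ w * d.σ w⁻¹ = 1 := by
  rw [← map_mul, mul_inv_cancel, map_one]

theorem σb_inv (d : WBC R A r t) (w : Equiv.Perm (Fin t)) : d.σb w * d.σb w⁻¹ = 1 := by
  rw [← map_mul, mul_inv_cancel, map_one]

theorem σ_inv' (d : WBC R A r t) (w : Equiv.Perm (Fin r)) : d.σ w⁻¹ * d.σ w = 1 := by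
  rw [← map_mul, inv_mul_cancel, map_one]

theorem σb_inv' (d : WBC R A r t) (w : Equiv.Perm (Fin t)) : d.σb w⁻¹ * d.σb w = 1 := by
  rw [← map_mul, inv_mul_cancel, map_one]

theorem σ_c (d : WBC R A r t) (w : Equiv.Perm (Fin r)) (i : Fin r) :
    d.σ w * d.c i = d.c (w i) * d.σ w := by
  rw [← d.c_conj, mul_assoc, d.σ_inv', mul_one]

theorem σb_cb (d : WBC R A r t) (w : Equiv.Perm (Fin t)) (i : Fin t) :
    d.σb w * d.cb i = d.cb (w i) * d.σb w := by
  rw [← d.cb_conj, mul_assoc, d.σb_inv', mul_one]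

/-- Conjugating `e` by permutations. -/
theorem F_conj (d : WBC R A r t) (hr : 0 < r) (ht : 0 < t) (w : Equiv.Perm (Fin r))
    (v : Equiv.Perm (Fin t)) :
    d.F hr ht (w ⟨0, hr⟩) (v ⟨0, ht⟩) = d.σ w * d.σb v * d.e * (d.σ w⁻¹ * d.σb v⁻¹) := by
  obtain ⟨w', hw'⟩ : ∃ w', w' = Equiv.swap ⟨0, hr⟩ (w ⟨0, hr⟩) * w := ⟨_, rfl⟩
  obtain ⟨v', hv'⟩ : ∃ v', v' = Equiv.swap ⟨0, ht⟩ (v ⟨0, ht⟩) * v := ⟨_, rfl⟩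
  have hw0 : w' ⟨0, hr⟩ = ⟨0, hr⟩ := by
    rw [hw', Equiv.Perm.mul_apply, Equiv.swap_apply_right]
  have hv0 : v' ⟨0, ht⟩ = ⟨0, ht⟩ := by
    rw [hv', Equiv.Perm.mul_apply, Equiv.swap_apply_right]
  have cw := fix_comm hr d.σ d.e d.s_e_comm w' hw0
  have cv := fix_comm ht d.σb d.e d.sb_e_comm v' hv0
  have ew : Equiv.swap ⟨0, hr⟩ (w ⟨0, hr⟩) * w' = w := by
    rw [hw', ← mul_assoc, Equiv.swap_mul_self, one_mul]
  have ev : Equiv.swap ⟨0, ht⟩ (v ⟨0, ht⟩) * v' = v := by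
    rw [hv', ← mul_assoc, Equiv.swap_mul_self, one_mul]
  have ew' : w⁻¹ = w'⁻¹ * Equiv.swap ⟨0, hr⟩ (w ⟨0, hr⟩) := by
    conv_lhs => rw [← ew, mul_inv_rev, Equiv.swap_inv]
  have ev' : v⁻¹ = v'⁻¹ * Equiv.swap ⟨0, ht⟩ (v ⟨0, ht⟩) := by
    conv_lhs => rw [← ev, mul_inv_rev, Equiv.swap_inv]
  rw [F, ew', ev', ← congrArg d.σ ew, ← congrArg d.σb ev]
  obtain ⟨p, hp⟩ : ∃ p, p = Equiv.swap ⟨0, hr⟩ (w ⟨0, hr⟩) := ⟨_, rfl⟩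
  obtain ⟨q, hq⟩ : ∃ q, q = Equiv.swap ⟨0, ht⟩ (v ⟨0, ht⟩) := ⟨_, rfl⟩
  rw [← hp, ← hq]
  simp only [map_mul]
  symm
  calc d.σ p * d.σ w' * (d.σb q * d.σb v') * d.e * (d.σ w'⁻¹ * d.σ p * (d.σb v'⁻¹ * d.σb q))
      = d.σ p * (d.σ w' * (d.σb q * d.σb v')) * d.e
          * (d.σ w'⁻¹ * (d.σ p * d.σb v'⁻¹) * d.σb q) := by simp only [mul_assoc]
    _ = d.σ p * (d.σb q * d.σb v' * d.σ w') * d.e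
          * (d.σ w'⁻¹ * (d.σb v'⁻¹ * d.σ p) * d.σb q) := by
        rw [← map_mul d.σb q v', d.comm_σσb, d.comm_σσb p]
    _ = d.σ p * d.σb q * d.σb v' * (d.σ w' * d.e)
          * (d.σ w'⁻¹ * d.σb v'⁻¹ * d.σ p * d.σb q) := by simp only [mul_assoc]
    _ = d.σ p * d.σb q * (d.σb v' * d.e) * (d.σ w' * d.σ w'⁻¹)
          * (d.σb v'⁻¹ * d.σ p * d.σb q) := by rw [cw.eq]; simp only [mul_assoc]
    _ = d.σ p * d.σb q * d.e * (d.σb v' * d.σb v'⁻¹) * (d.σ p * d.σb q) := by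
        rw [cv.eq, d.σ_inv, mul_one]; simp only [mul_assoc]
    _ = _ := by rw [d.σb_inv, mul_one, d.comm_σσb]; simp only [mul_assoc]; rw [d.comm_σσb]

theorem F_zero (d : WBC R A r t) (hr : 0 < r) (ht : 0 < t) :
    d.F hr ht ⟨0, hr⟩ ⟨0, ht⟩ = d.e := by
  rw [F, Equiv.swap_self, Equiv.swap_self]
  show d.σb 1 * d.σ 1 * d.e * d.σ 1 * d.σb 1 = d.e
  simp

theorem ex_perm {n : ℕ} (hn : 0 < n) (a : Fin n) : ∃ w : Equiv.Perm (Fin n), w ⟨0, hn⟩ = a :=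
  ⟨Equiv.swap ⟨0, hn⟩ a, Equiv.swap_apply_left _ _⟩

theorem σ_F (d : WBC R A r t) (hr : 0 < r) (ht : 0 < t) (u : Equiv.Perm (Fin r)) (a : Fin r)
    (j : Fin t) : d.σ u * d.F hr ht a j = d.F hr ht (u a) j * d.σ u := by
  obtain ⟨w, rfl⟩ := ex_perm hr a
  obtain ⟨v, rfl⟩ := ex_perm ht j
  rw [show u (w ⟨0, hr⟩) = (u * w) ⟨0, hr⟩ from rfl, d.F_conj, d.F_conj, map_mul, mul_inv_rev,
    map_mul]
  calc _ = d.σ u * d.σ w * d.σb v * d.e * (d.σ w⁻¹ * 1 * d.σb v⁻¹) := by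
        simp only [mul_assoc, one_mul]
    _ = _ := by
        rw [← d.σ_inv' u]; simp only [mul_assoc]; rw [d.comm_σσb u]

theorem σb_F (d : WBC R A r t) (hr : 0 < r) (ht : 0 < t) (u : Equiv.Perm (Fin t)) (a : Fin r)
    (j : Fin t) : d.σb u * d.F hr ht a j = d.F hr ht a (u j) * d.σb u := by
  obtain ⟨w, rfl⟩ := ex_perm hr a
  obtain ⟨v, rfl⟩ := ex_perm ht j
  rw [show u (v ⟨0, ht⟩) = (u * v) ⟨0, ht⟩ from rfl, d.F_conj, d.F_conj, map_mul, mul_inv_rev,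
    map_mul]
  calc _ = (d.σb u * d.σ w) * d.σb v * d.e * (d.σ w⁻¹ * (d.σb v⁻¹ * 1)) := by
        simp only [mul_assoc, mul_one]
    _ = _ := by
        rw [← d.σb_inv' u, ← d.comm_σσb w u]; simp only [mul_assoc]

/-- Transport of products of two `F`s along a permutation. -/
theorem F_transport (d : WBC R A r t) (hr : 0 < r) (ht : 0 < t) (w : Equiv.Perm (Fin r))
    (v : Equiv.Perm (Fin t)) (a : Fin r) (j : Fin t) :
    d.F hr ht (w a) (v j) * (d.σ w * d.σb v) = (d.σ w * d.σb v) * d.F hr ht a j := by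
  rw [mul_assoc, d.σb_F, ← mul_assoc, ← d.σ_F, mul_assoc]

theorem U_cancel (d : WBC R A r t) (w : Equiv.Perm (Fin r)) (v : Equiv.Perm (Fin t)) {x y : A}
    (h : x * (d.σ w * d.σb v) = y * (d.σ w * d.σb v)) : x = y := by
  have h1 : ∀ z : A, z = z * (d.σ w * d.σb v) * (d.σb v⁻¹ * d.σ w⁻¹) := by
    intro z
    calc z = z * (d.σ w * (d.σb v * d.σb v⁻¹) * d.σ w⁻¹) := by
          rw [d.σb_inv, mul_one, d.σ_inv, mul_one]
      _ = _ := by simp only [mul_assoc]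
  rw [h1 x, h, ← h1]

theorem tr_mul {x y U x' y' : A} (hx : x * U = U * x') (hy : y * U = U * y') :
    x * y * U = U * (x' * y') := by
  rw [mul_assoc, hy, ← mul_assoc, hx, mul_assoc]

theorem swap_transport (d : WBC R A r t) (w : Equiv.Perm (Fin r))
    (v : Equiv.Perm (Fin t)) (a b : Fin r) :
    d.σ (Equiv.swap (w a) (w b)) * (d.σ w * d.σb v)
      = (d.σ w * d.σb v) * d.σ (Equiv.swap a b) := by
  rw [mul_assoc, ← d.comm_σσb, ← mul_assoc, ← mul_assoc, ← map_mul, ← map_mul,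
    Equiv.mul_swap_eq_swap_mul]

theorem swapb_transport (d : WBC R A r t) (w : Equiv.Perm (Fin r))
    (v : Equiv.Perm (Fin t)) (a b : Fin t) :
    d.σb (Equiv.swap (v a) (v b)) * (d.σ w * d.σb v)
      = (d.σ w * d.σb v) * d.σb (Equiv.swap a b) := by
  rw [mul_assoc, ← mul_assoc, ← d.comm_σσb, mul_assoc, ← map_mul, ← map_mul,
    Equiv.mul_swap_eq_swap_mul]

theorem c_transport (d : WBC R A r t) (w : Equiv.Perm (Fin r)) (v : Equiv.Perm (Fin t))
    (a : Fin r) : d.c (w a) * (d.σ w * d.σb v) = (d.σ w * d.σb v) * d.c a := by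
  rw [mul_assoc, d.comm_σbc, ← mul_assoc, ← mul_assoc, ← d.σ_c]

theorem cb_transport (d : WBC R A r t) (w : Equiv.Perm (Fin r)) (v : Equiv.Perm (Fin t))
    (j : Fin t) : d.cb (v j) * (d.σ w * d.σb v) = (d.σ w * d.σb v) * d.cb j := by
  rw [mul_assoc, d.σb_cb, ← mul_assoc, ← mul_assoc, d.comm_σcb]

theorem e_F11 (d : WBC R A r t) (hr : 0 < r) (ht : 0 < t) (h1 : 1 < r) (h2 : 1 < t) :
    d.e * d.F hr ht ⟨1, h1⟩ ⟨1, h2⟩ = d.F hr ht ⟨1, h1⟩ ⟨1, h2⟩ * d.e := by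
  have b1 := d.braid1 h1 h2
  have b2 := d.braid2 h1 h2
  rw [sw_eq hr h1, sw_eq ht h2] at b1 b2
  rw [F]
  obtain ⟨s, hs⟩ : ∃ s, s = d.σ (Equiv.swap ⟨0, hr⟩ ⟨1, h1⟩) := ⟨_, rfl⟩
  obtain ⟨u, hu⟩ : ∃ u, u = d.σb (Equiv.swap ⟨0, ht⟩ ⟨1, h2⟩) := ⟨_, rfl⟩
  have su : s * u = u * s := by rw [hs, hu, d.comm_σσb]
  have uu : u * u = 1 := by rw [hu, ← map_mul, Equiv.swap_mul_self, map_one]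
  rw [← hs, ← hu] at b1 b2 ⊢
  have l : d.e * (u * s * d.e * s * u) = d.e * s * u * d.e := by
    calc d.e * (u * s * d.e * s * u) = (d.e * s * u * d.e * s) * u := by
          rw [← su]; simp only [mul_assoc]
      _ = d.e * s * u * d.e * (u * u) := by rw [b1]; simp only [mul_assoc]
      _ = _ := by rw [uu, mul_one]
  have rr : u * s * d.e * s * u * d.e = d.e * s * u * d.e := by
    calc u * s * d.e * s * u * d.e = u * (s * d.e * s * u * d.e) := by simp only [mul_assoc]
      _ = (u * u) * (d.e * s * u * d.e) := by rw [b2]; simp only [mul_assoc]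
      _ = _ := by rw [uu, one_mul]
  rw [l, rr]

/-- The local relations hold in the walled Brauer–Clifford superalgebra. -/
def toLoc (d : WBC R A r t) (hr : 0 < r) (ht : 0 < t) : Loc A (Fin r) (Fin t) where
  η := 1
  hη := Or.inl rfl
  τ := fun a b => d.σ (Equiv.swap a b)
  τb := fun a b => d.σb (Equiv.swap a b)
  c := d.c
  cb := d.cb
  E := d.F hr ht
  τ_symm := by intro a b; rw [Equiv.swap_comm]
  τb_symm := by intro a b; rw [Equiv.swap_comm]
  τ_sq := by intro a b; rw [← map_mul, Equiv.swap_mul_self, map_one]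
  τb_sq := by intro a b; rw [← map_mul, Equiv.swap_mul_self, map_one]
  τ_τ := by
    intro k l a h1 h2 h3
    rw [← map_mul, ← map_mul, Equiv.mul_swap_eq_swap_mul, Equiv.swap_apply_left,
      Equiv.swap_apply_of_ne_of_ne h2.symm h3.symm]
  τb_τb := by
    intro k l a h1 h2 h3
    rw [← map_mul, ← map_mul, Equiv.mul_swap_eq_swap_mul, Equiv.swap_apply_left,
      Equiv.swap_apply_of_ne_of_ne h2.symm h3.symm]
  τ_τ_ne := by
    intro k l m a h1 h2 h3 h4
    rw [← map_mul, ← map_mul, Equiv.mul_swap_eq_swap_mul,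
      Equiv.swap_apply_of_ne_of_ne h1.symm h3.symm, Equiv.swap_apply_of_ne_of_ne h2.symm h4.symm]
  τb_τb_ne := by
    intro k l m a h1 h2 h3 h4
    rw [← map_mul, ← map_mul, Equiv.mul_swap_eq_swap_mul,
      Equiv.swap_apply_of_ne_of_ne h1.symm h3.symm, Equiv.swap_apply_of_ne_of_ne h2.symm h4.symm]
  c_sq := d.c_sq
  cb_sq := d.cb_sq
  c_anti := d.c_anti
  cb_anti := d.cb_anti
  c_cb := d.anti_ccb
  τ_c := by intro a b; rw [d.σ_c, Equiv.swap_apply_right]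
  τb_cb := by intro a b; rw [d.σb_cb, Equiv.swap_apply_right]
  τ_c_ne := by intro a b k h1 h2; rw [d.σ_c, Equiv.swap_apply_of_ne_of_ne h1 h2]
  τb_cb_ne := by intro a b k h1 h2; rw [d.σb_cb, Equiv.swap_apply_of_ne_of_ne h1 h2]
  τ_E := by intro a b j; rw [d.σ_F, Equiv.swap_apply_right]
  τb_E := by intro a b j; rw [d.σb_F, Equiv.swap_apply_right]
  τ_E_ne := by intro a b k j h1 h2; rw [d.σ_F, Equiv.swap_apply_of_ne_of_ne h1 h2]
  τb_E_ne := by intro j l m a h1 h2; rw [d.σb_F, Equiv.swap_apply_of_ne_of_ne h1 h2]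
  τ_τb := by intro a b j l; rw [d.comm_σσb]
  τ_cb := by intro a b j; rw [d.comm_σcb]
  τb_c := by intro a b j; rw [d.comm_σbc]
  E_c := by
    intro a j
    obtain ⟨w, rfl⟩ := ex_perm hr a
    obtain ⟨v, rfl⟩ := ex_perm ht j
    apply d.U_cancel w v
    rw [tr_mul (d.F_transport hr ht w v _ _) (d.c_transport w v _),
      tr_mul (d.F_transport hr ht w v _ _) (d.cb_transport w v _), d.F_zero, d.e_c1 hr ht]
  c_E := by
    intro a j
    obtain ⟨w, rfl⟩ := ex_perm hr a
    obtain ⟨v, rfl⟩ := ex_perm ht j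
    apply d.U_cancel w v
    rw [tr_mul (d.c_transport w v _) (d.F_transport hr ht w v _ _),
      tr_mul (d.cb_transport w v _) (d.F_transport hr ht w v _ _), d.F_zero, d.c1_e hr ht]
  c_E_ne := by
    intro k a j hka
    obtain ⟨w, rfl⟩ := ex_perm hr a
    obtain ⟨v, rfl⟩ := ex_perm ht j
    obtain ⟨k, rfl⟩ := w.surjective k
    apply d.U_cancel w v
    have hk : (k : ℕ) ≠ 0 := fun h => hka (congrArg w (Fin.ext h))
    rw [tr_mul (d.c_transport w v _) (d.F_transport hr ht w v _ _),
      tr_mul (d.F_transport hr ht w v _ _) (d.c_transport w v _), d.F_zero, d.c_e_comm k hk]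
  cb_E_ne := by
    intro k a j hkj
    obtain ⟨w, rfl⟩ := ex_perm hr a
    obtain ⟨v, rfl⟩ := ex_perm ht j
    obtain ⟨k, rfl⟩ := v.surjective k
    apply d.U_cancel w v
    have hk : (k : ℕ) ≠ 0 := fun h => hkj (congrArg v (Fin.ext h))
    rw [tr_mul (d.cb_transport w v _) (d.F_transport hr ht w v _ _),
      tr_mul (d.F_transport hr ht w v _ _) (d.cb_transport w v _), d.F_zero, d.cb_e_comm k hk]
  E_sq := by
    intro a j
    obtain ⟨w, rfl⟩ := ex_perm hr a
    obtain ⟨v, rfl⟩ := ex_perm ht j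
    apply d.U_cancel w v
    rw [mul_assoc, d.F_transport, ← mul_assoc, d.F_transport, mul_assoc, d.F_zero, d.e_sq,
      mul_zero, zero_mul]
  E_c_E := by
    intro a j
    obtain ⟨w, rfl⟩ := ex_perm hr a
    obtain ⟨v, rfl⟩ := ex_perm ht j
    apply d.U_cancel w v
    rw [mul_assoc, d.F_transport, ← mul_assoc, mul_assoc (d.F hr ht _ _), d.c_transport,
      ← mul_assoc, d.F_transport, mul_assoc, mul_assoc, d.F_zero, ← mul_assoc d.e, d.e_c_e,
      mul_zero, zero_mul]
  E_τ_E := by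
    intro a b j hab
    have h1 : 1 < r := by
      rcases Nat.lt_or_ge 1 r with h | h
      · exact h
      · exact absurd (Fin.ext (by omega)) hab
    have h01 : (⟨0, hr⟩ : Fin r) ≠ ⟨1, h1⟩ := by simp
    obtain ⟨w, rfl, rfl⟩ := two_trans h01 hab
    obtain ⟨v, rfl⟩ := ex_perm ht j
    apply d.U_cancel w v
    have := d.e_s_e h1
    rw [sw_eq hr h1] at this
    rw [mul_assoc, d.F_transport, ← mul_assoc, mul_assoc (d.F hr ht _ _), d.swap_transport,
      ← mul_assoc, d.F_transport, mul_assoc, mul_assoc, d.F_zero, ← mul_assoc d.e, this]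
  E_τb_E := by
    intro a j l hjl
    have h1 : 1 < t := by
      rcases Nat.lt_or_ge 1 t with h | h
      · exact h
      · exact absurd (Fin.ext (by omega)) hjl
    have h01 : (⟨0, ht⟩ : Fin t) ≠ ⟨1, h1⟩ := by simp
    obtain ⟨v, rfl, rfl⟩ := two_trans h01 hjl
    obtain ⟨w, rfl⟩ := ex_perm hr a
    apply d.U_cancel w v
    have := d.e_sb_e h1
    rw [sw_eq ht h1] at this
    rw [mul_assoc, d.F_transport, ← mul_assoc, mul_assoc (d.F hr ht _ _), d.swapb_transport,
      ← mul_assoc, d.F_transport, mul_assoc, mul_assoc, d.F_zero, ← mul_assoc d.e, this]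
  E_E := by
    intro a b j l hab hjl
    have h1 : 1 < r := by
      rcases Nat.lt_or_ge 1 r with h | h
      · exact h
      · exact absurd (Fin.ext (by omega)) hab
    have h2 : 1 < t := by
      rcases Nat.lt_or_ge 1 t with h | h
      · exact h
      · exact absurd (Fin.ext (by omega)) hjl
    have h01 : (⟨0, hr⟩ : Fin r) ≠ ⟨1, h1⟩ := by simp
    have h01' : (⟨0, ht⟩ : Fin t) ≠ ⟨1, h2⟩ := by simp
    obtain ⟨w, rfl, rfl⟩ := two_trans h01 hab
    obtain ⟨v, rfl, rfl⟩ := two_trans h01' hjl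
    apply d.U_cancel w v
    rw [tr_mul (d.F_transport hr ht w v _ _) (d.F_transport hr ht w v _ _),
      tr_mul (d.F_transport hr ht w v _ _) (d.F_transport hr ht w v _ _), d.F_zero, d.e_F11]

end WBC
namespace Loc
variable {A I J : Type} [Ring A] [DecidableEq I] [DecidableEq J]

theorem E_Y_diff (d : Loc A I J) {b : J} (a : I) (S : Finset I) {S' : Finset J} (hb : b ∉ S') :
    d.E a b * d.Y a S S' = d.E a b * ((∑ j ∈ S', d.swap.M j b) - ∑ k ∈ S, d.M k a) := by
  have h1 : d.E a b * ∑ j ∈ S', d.O a j = d.E a b * ∑ j ∈ S', d.swap.M j b := by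
    rw [Finset.mul_sum, Finset.mul_sum]
    refine Finset.sum_congr rfl fun j hj => ?_
    have hjb : j ≠ b := fun e => hb (e ▸ hj)
    exact d.E_O8 a hjb
  rw [Y, mul_sub, mul_sub, h1]

theorem E_swapY_diff (d : Loc A I J) {a : I} (b : J) {S : Finset I} (S' : Finset J) (ha : a ∉ S) :
    d.E a b * d.swap.Y b S' S = d.E a b * ((∑ k ∈ S, d.M k a) - ∑ j ∈ S', d.swap.M j b) := by
  have := d.swap.E_Y_diff b S' ha
  rw [swap_swap] at this
  exact this

theorem τ_Y_τ (d : Loc A I J) {k a : I} {S : Finset I} (S' : Finset J) (hka : k ≠ a) (hk : k ∉ S)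
    (ha : a ∉ S) : d.τ k a * d.Y k S S' * d.τ k a = d.Y a S S' := by
  rw [d.τ_Y_conj S' hka hk ha, mul_assoc, d.τ_sq, mul_one]

theorem Y_tilde (d : Loc A I J) {k a : I} {S : Finset I} (S' : Finset J)
    (hka : k ≠ a) (hk : k ∉ S) (ha : a ∉ S) :
    d.τ k a * d.Y k S S' * d.τ k a - (1 - d.η * (d.c k * d.c a)) * d.τ k a
      = d.Y a (insert k S) S' := by
  rw [d.τ_Y_τ S' hka hk ha, d.Y_insert a S' hk, ← d.M_τ hka, mul_assoc, d.τ_sq, mul_one]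

theorem E_swap_commute (d : Loc A I J) {a : I} {b : J}
    {S : Finset I} {S' : Finset J} (ha : a ∉ S) (hb : b ∉ S') :
    Commute (d.Y a S S') (d.E a b + d.swap.Y b S' S - d.η * (d.c a * d.E a b * d.c a)) := by
  have h1 : d.E a b + d.swap.Y b S' S - d.η * (d.c a * d.E a b * d.c a)
      = d.swap.Y b S' (insert a S) := by
    rw [d.swap.Y_insert' b S' ha, d.swap_O]; abel
  rw [h1]
  have := d.swap.swapY_Y (j := a) (a := b) (S := S') (S' := insert a S) (T := S') (T' := S) hb
    (Finset.mem_insert_self _ _) (Finset.Subset.refl _) (Finset.subset_insert _ _)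
  rw [swap_swap] at this
  exact this

end Loc

namespace WBC
variable {R A : Type} [CommRing R] [Ring A] [Algebra R A] {r t : ℕ}

/-- Zero-based index set corresponding to `{1, …, i-1}`. -/
def low (n i : ℕ) : Finset (Fin n) := Finset.univ.filter fun x => (x : ℕ) + 1 < i

theorem mem_low {n i : ℕ} {x : Fin n} : x ∈ low n i ↔ (x : ℕ) + 1 < i := by
  simp [low]

theorem sum_low {n i : ℕ} (hi : i ≤ n + 1) (f : ℕ → A) :
    ∑ j ∈ Finset.Ico 1 i, f j = ∑ x ∈ low n i, f ((x : ℕ) + 1) := by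
  symm
  refine Finset.sum_bij (fun x _ => (x : ℕ) + 1) ?_ ?_ ?_ ?_
  · intro x hx
    rw [mem_low] at hx
    rw [Finset.mem_Ico]; omega
  · intro x _ y _ h
    exact Fin.ext (by omega)
  · intro j hj
    rw [Finset.mem_Ico] at hj
    exact ⟨⟨j - 1, by omega⟩, by rw [mem_low]; simp only; omega, by simp only; omega⟩
  · intro x _; rfl

theorem card_low {n i : ℕ} (hi : i ≤ n + 1) : (low n i).card = i - 1 := by
  have := sum_low (A := ℤ) hi (fun _ => 1)
  simp at this
  omega

theorem cn_eq (d : WBC R A r t) {i : ℕ} (h : i - 1 < r) : d.cn i = d.c ⟨i - 1, h⟩ := by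
  rw [cn, dif_pos h]

theorem cbn_eq (d : WBC R A r t) {i : ℕ} (h : i - 1 < t) : d.cbn i = d.cb ⟨i - 1, h⟩ := by
  rw [cbn, dif_pos h]

theorem cn_succ (d : WBC R A r t) {i : ℕ} (h : i < r) : d.cn (i + 1) = d.c ⟨i, h⟩ :=
  d.cn_eq (i := i + 1) h

theorem cbn_succ (d : WBC R A r t) {i : ℕ} (h : i < t) : d.cbn (i + 1) = d.cb ⟨i, h⟩ :=
  d.cbn_eq (i := i + 1) h

theorem s_eq (d : WBC R A r t) {j : ℕ} (h0 : j - 1 < r) (h : j < r) :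
    d.s j = d.σ (Equiv.swap ⟨j - 1, h0⟩ ⟨j, h⟩) := by
  rw [s, sw_eq h0 h]

theorem sb_eq (d : WBC R A r t) {j : ℕ} (h0 : j - 1 < t) (h : j < t) :
    d.sb j = d.σb (Equiv.swap ⟨j - 1, h0⟩ ⟨j, h⟩) := by
  rw [sb, sw_eq h0 h]

theorem E_eq (d : WBC R A r t) {i j : ℕ} (hi : i - 1 < r) (hj : j - 1 < t) :
    d.E i j = d.F (by omega) (by omega) ⟨i - 1, hi⟩ ⟨j - 1, hj⟩ := by
  have h1 : d.tr 1 i = d.σ (Equiv.swap ⟨0, by omega⟩ ⟨i - 1, hi⟩) := by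
    rw [tr]; exact congrArg d.σ (sw_eq (by omega) hi)
  have h2 : d.trb 1 j = d.σb (Equiv.swap ⟨0, by omega⟩ ⟨j - 1, hj⟩) := by
    rw [trb]; exact congrArg d.σb (sw_eq (by omega) hj)
  rw [E, h1, h2, F]

theorem L_eq (d : WBC R A r t) (hr : 0 < r) (ht : 0 < t) {i : ℕ} (h1 : 1 ≤ i) (hi : i - 1 < r) :
    d.L i = ∑ k ∈ low r i, (d.toLoc hr ht).M k ⟨i - 1, hi⟩ := by
  rw [L, LL, sum_low (n := r) (by omega), Finset.mul_sum, Finset.sum_mul,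
    ← Finset.sum_add_distrib]
  refine Finset.sum_congr rfl fun k _ => ?_
  rw [d.cn_eq hi, tr, sw_eq (by simp) hi]
  simp [Loc.M, toLoc]

theorem Lb_eq (d : WBC R A r t) (hr : 0 < r) (ht : 0 < t) {i : ℕ} (h1 : 1 ≤ i) (hi : i - 1 < t) :
    d.Lb i = ∑ k ∈ low t i, (d.toLoc hr ht).swap.M k ⟨i - 1, hi⟩ := by
  rw [Lb, LLb, sum_low (n := t) (by omega), Finset.mul_sum, Finset.sum_mul,
    ← Finset.sum_sub_distrib]
  refine Finset.sum_congr rfl fun k _ => ?_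
  rw [d.cbn_eq hi, trb, sw_eq (by simp) hi]
  simp [Loc.M, toLoc, Loc.swap, sub_eq_add_neg]

theorem y_eq (d : WBC R A r t) (hr : 0 < r) (ht : 0 < t) {i : ℕ} (h1 : 1 ≤ i) (hi : i - 1 < r)
    (hit : i ≤ t + 1) :
    d.y i = (d.toLoc hr ht).Y ⟨i - 1, hi⟩ (low r i) (low t i) := by
  rw [y, d.L_eq hr ht h1 hi, sum_low (n := t) hit, Loc.Y]
  congr 1
  refine Finset.sum_congr rfl fun j _ => ?_
  rw [Eb, d.cn_eq hi, d.E_eq (j := (j : ℕ) + 1) hi (by simp)]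
  simp [Loc.O, toLoc]

theorem yb_eq (d : WBC R A r t) (hr : 0 < r) (ht : 0 < t) {i : ℕ} (h1 : 1 ≤ i) (hi : i - 1 < t)
    (hit : i ≤ r + 1) :
    d.yb i = (d.toLoc hr ht).swap.Y ⟨i - 1, hi⟩ (low t i) (low r i) := by
  rw [yb, d.Lb_eq hr ht h1 hi, sum_low (n := r) hit, Loc.Y]
  congr 1
  refine Finset.sum_congr rfl fun j _ => ?_
  rw [Loc.swap_O, Eb, d.cn_eq (i := (j : ℕ) + 1) (by simp),
    d.E_eq (i := (j : ℕ) + 1) (by simp) hi]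
  simp [toLoc]

end WBC
/-- Lemma 2.9: identities for the elements `y_i`, `ȳ_i` in `BC_{r,t}`
(all indices 1-based, quantified over all admissible values). -/
theorem statement2 (R A : Type) [CommRing R] [IsDomain R] [Ring A] [Algebra R A]
    (h2 : IsUnit (2 : R)) (r t : ℕ) (hr : 1 ≤ r) (ht : 1 ≤ t)
    (d : WBC R A r t) (hu : d.IsUniversal) :
    -- (1)
    (∀ i j : ℕ, 1 ≤ i → i ≤ r → i ≤ t + 1 → 1 ≤ j → j + 1 ≤ r → j ≠ i - 1 → j ≠ i →
      d.s j * d.y i = d.y i * d.s j) ∧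
    (∀ i j : ℕ, 1 ≤ i → i ≤ t → i ≤ r + 1 → 1 ≤ j → j + 1 ≤ t → j ≠ i - 1 → j ≠ i →
      d.sb j * d.yb i = d.yb i * d.sb j) ∧
    -- (2)
    (∀ i j : ℕ, 1 ≤ i → i ≤ t → i ≤ r + 1 → 1 ≤ j → j + 1 ≤ r → j ≠ i - 1 →
      d.s j * d.yb i = d.yb i * d.s j) ∧
    (∀ i j : ℕ, 1 ≤ i → i ≤ r → i ≤ t + 1 → 1 ≤ j → j + 1 ≤ t → j ≠ i - 1 →
      d.sb j * d.y i = d.y i * d.sb j) ∧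
    -- (3)
    (∀ i : ℕ, 1 ≤ i → i ≤ r → i ≤ t + 1 → d.y i * d.cn i = -(d.cn i * d.y i)) ∧
    (∀ i : ℕ, 1 ≤ i → i ≤ t → i ≤ r + 1 → d.yb i * d.cbn i = -(d.cbn i * d.yb i)) ∧
    -- (4)
    (∀ i j : ℕ, 1 ≤ i → i ≤ r → i ≤ t + 1 → 1 ≤ j → j ≤ r → i ≠ j →
      d.y i * d.cn j = d.cn j * d.y i) ∧
    (∀ i j : ℕ, 1 ≤ i → i ≤ t → i ≤ r + 1 → 1 ≤ j → j ≤ t → i ≠ j →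
      d.yb i * d.cbn j = d.cbn j * d.yb i) ∧
    -- (5)
    (∀ i j : ℕ, 1 ≤ i → i ≤ r → i ≤ t + 1 → j ≤ t → i ≤ j →
      d.y i * d.cbn j = d.cbn j * d.y i) ∧
    (∀ i j : ℕ, 1 ≤ i → i ≤ t → i ≤ r + 1 → j ≤ r → i ≤ j →
      d.yb i * d.cn j = d.cn j * d.yb i) ∧
    -- (6)
    (∀ i : ℕ, 1 ≤ i → i + 1 ≤ r → i ≤ t → d.y i * d.y (i + 1) = d.y (i + 1) * d.y i) ∧
    (∀ i : ℕ, 1 ≤ i → i + 1 ≤ t → i ≤ r → d.yb i * d.yb (i + 1) = d.yb (i + 1) * d.yb i) ∧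
    -- (7)
    (∀ i : ℕ, 1 ≤ i → i ≤ r → i ≤ t →
      d.y i * (d.E i i + d.yb i - d.Eb i i) = (d.E i i + d.yb i - d.Eb i i) * d.y i) ∧
    -- (8)
    (∀ i : ℕ, 1 ≤ i → i ≤ r → i ≤ t →
      d.E i i * d.yb i = d.E i i * (d.L i - d.Lb i) ∧
      d.E i i * d.y i = d.E i i * (d.Lb i - d.L i)) ∧
    -- (9)
    (∀ i : ℕ, 1 ≤ i → i + 1 ≤ r → i ≤ t →
      d.E i i * (d.s i * d.y i * d.s i) = d.s i * d.y i * d.s i * d.E i i) ∧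
    (∀ j : ℕ, 1 ≤ j → j + 1 ≤ t → j ≤ r →
      d.E j j * (d.sb j * d.yb j * d.sb j) = d.sb j * d.yb j * d.sb j * d.E j j) ∧
    -- (10)
    (∀ i : ℕ, 1 ≤ i → i + 1 ≤ r → i ≤ t + 1 →
      d.y i * (d.s i * d.y i * d.s i - (1 - d.cn i * d.cn (i + 1)) * d.s i)
        = (d.s i * d.y i * d.s i - (1 - d.cn i * d.cn (i + 1)) * d.s i) * d.y i) ∧
    (∀ i : ℕ, 1 ≤ i → i + 1 ≤ t → i ≤ r + 1 →
      d.yb i * (d.sb i * d.yb i * d.sb i - (1 + d.cbn i * d.cbn (i + 1)) * d.sb i)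
        = (d.sb i * d.yb i * d.sb i - (1 + d.cbn i * d.cbn (i + 1)) * d.sb i) * d.yb i) ∧
    -- (11)
    (∀ i k : ℕ, 1 ≤ i → i ≤ r → i ≤ t → d.E i i * d.y i ^ k * d.cn i * d.E i i = 0) ∧
    -- (12)
    (∀ i n : ℕ, 1 ≤ i → i ≤ r → i ≤ t →
      d.E i i * d.y i ^ (2 * n) * d.E i i = 0 ∧ d.E i i * d.yb i ^ (2 * n) * d.E i i = 0) ∧
    -- (13)
    (∀ i : ℕ, 1 ≤ i → i ≤ r → i ≤ t →
      d.E i i * d.y i * d.E i i = 0 ∧ d.E i i * d.yb i * d.E i i = 0) := by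
  have hA : IsUnit (2 : A) := by
    have := h2.map (algebraMap R A)
    rwa [map_ofNat] at this
  obtain ⟨D, hD⟩ : ∃ D, D = d.toLoc hr ht := ⟨_, rfl⟩
  have nm : ∀ {n i k : ℕ} (h : k < n), i ≤ k + 1 → (⟨k, h⟩ : Fin n) ∉ WBC.low n i := by
    intro n i k h hk; rw [WBC.mem_low]; simp only; omega
  have fne : ∀ {n k l : ℕ} (h : k < n) (h' : l < n), k ≠ l → (⟨k, h⟩ : Fin n) ≠ ⟨l, h'⟩ := by
    intro n k l h h' hkl e; exact hkl (congrArg Fin.val e)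
  have io : ∀ {n i j : ℕ} (h0 : j - 1 < n) (h : j < n), 1 ≤ i → 1 ≤ j → j ≠ i - 1 →
      ((⟨j - 1, h0⟩ : Fin n) ∈ WBC.low n i ∧ (⟨j, h⟩ : Fin n) ∈ WBC.low n i) ∨
      ((⟨j - 1, h0⟩ : Fin n) ∉ WBC.low n i ∧ (⟨j, h⟩ : Fin n) ∉ WBC.low n i) := by
    intro n i j h0 h hi hj hji
    simp only [WBC.mem_low]; omega
  have hy : ∀ {i : ℕ}, 1 ≤ i → ∀ hi : i - 1 < r, i ≤ t + 1 →
      d.y i = D.Y ⟨i - 1, hi⟩ (WBC.low r i) (WBC.low t i) := by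
    intro i h1 hi hit; rw [hD]; exact d.y_eq hr ht h1 hi hit
  have hyb : ∀ {i : ℕ}, 1 ≤ i → ∀ hi : i - 1 < t, i ≤ r + 1 →
      d.yb i = D.swap.Y ⟨i - 1, hi⟩ (WBC.low t i) (WBC.low r i) := by
    intro i h1 hi hit; rw [hD]; exact d.yb_eq hr ht h1 hi hit
  have hs : ∀ {j : ℕ} (h0 : j - 1 < r) (h : j < r), d.s j = D.τ ⟨j - 1, h0⟩ ⟨j, h⟩ := by
    intro j h0 h; rw [hD]; exact d.s_eq h0 h
  have hsb : ∀ {j : ℕ} (h0 : j - 1 < t) (h : j < t), d.sb j = D.τb ⟨j - 1, h0⟩ ⟨j, h⟩ := by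
    intro j h0 h; rw [hD]; exact d.sb_eq h0 h
  have hc : ∀ {i : ℕ} (h : i - 1 < r), d.cn i = D.c ⟨i - 1, h⟩ := by
    intro i h; rw [hD]; exact d.cn_eq h
  have hcb : ∀ {i : ℕ} (h : i - 1 < t), d.cbn i = D.cb ⟨i - 1, h⟩ := by
    intro i h; rw [hD]; exact d.cbn_eq h
  have hc' : ∀ {i : ℕ} (h : i < r), d.cn (i + 1) = D.c ⟨i, h⟩ := by
    intro i h; rw [hD]; exact d.cn_succ h
  have hcb' : ∀ {i : ℕ} (h : i < t), d.cbn (i + 1) = D.cb ⟨i, h⟩ := by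
    intro i h; rw [hD]; exact d.cbn_succ h
  have hE : ∀ {i : ℕ} (h : i - 1 < r) (h' : i - 1 < t),
      d.E i i = D.E ⟨i - 1, h⟩ ⟨i - 1, h'⟩ := by
    intro i h h'; rw [hD]; exact d.E_eq h h'
  have hη : D.η = 1 := by rw [hD]; rfl
  have hL : ∀ {i : ℕ}, 1 ≤ i → ∀ hi : i - 1 < r,
      d.L i = ∑ k ∈ WBC.low r i, D.M k ⟨i - 1, hi⟩ := by
    intro i h1 hi; rw [hD]; exact d.L_eq hr ht h1 hi
  have hLb : ∀ {i : ℕ}, 1 ≤ i → ∀ hi : i - 1 < t,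
      d.Lb i = ∑ k ∈ WBC.low t i, D.swap.M k ⟨i - 1, hi⟩ := by
    intro i h1 hi; rw [hD]; exact d.Lb_eq hr ht h1 hi
  have sub : ∀ {n i j : ℕ}, i ≤ j → WBC.low n i ⊆ WBC.low n j := by
    intro n i j hij x hx
    rw [WBC.mem_low] at hx ⊢; omega
  clear hD hu
  refine ⟨?_, ?_, ?_, ?_, ?_, ?_, ?_, ?_, ?_, ?_, ?_, ?_, ?_, ?_, ?_, ?_, ?_, ?_, ?_, ?_, ?_⟩
  · intro i j h1 h2 h3 h4 h5 h6 h7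
    rw [hs (by omega) (by omega), hy h1 (by omega) h3]
    exact D.τ_Y _ (fne _ _ (by omega)) (fne _ _ (by omega)) (fne _ _ (by omega))
      (nm _ (by omega)) (io _ _ h1 h4 h6)
  · intro i j h1 h2 h3 h4 h5 h6 h7
    rw [hsb (by omega) (by omega), hyb h1 (by omega) h3]
    exact D.swap.τ_Y _ (fne _ _ (by omega)) (fne _ _ (by omega)) (fne _ _ (by omega))
      (nm _ (by omega)) (io _ _ h1 h4 h6)
  · intro i j h1 h2 h3 h4 h5 h6
    rw [hs (by omega) (by omega), hyb h1 (by omega) h3]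
    exact D.swap.τb_Y _ _ (io _ _ h1 h4 h6)
  · intro i j h1 h2 h3 h4 h5 h6
    rw [hsb (by omega) (by omega), hy h1 (by omega) h3]
    exact D.τb_Y _ _ (io _ _ h1 h4 h6)
  · intro i h1 h2 h3
    rw [hc (by omega), hy h1 (by omega) h3, D.Y_anti, neg_neg]
  · intro i h1 h2 h3
    rw [hcb (by omega), hyb h1 (by omega) h3]
    have := D.swap.Y_anti ⟨i - 1, by omega⟩ (WBC.low t i) (WBC.low r i)
    exact neg_eq_iff_eq_neg.mp (neg_eq_iff_eq_neg.mpr (eq_neg_iff_add_eq_zero.mpr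
      (by rw [add_comm]; exact eq_neg_iff_add_eq_zero.mp this)))
  · intro i j h1 h2 h3 h4 h5 h6
    rw [hc (i := j) (by omega), hy h1 (by omega) h3]
    exact (D.c_Y _ (nm _ (by omega)) (fne _ _ (by omega))).symm
  · intro i j h1 h2 h3 h4 h5 h6
    rw [hcb (i := j) (by omega), hyb h1 (by omega) h3]
    exact (D.swap.c_Y _ (nm _ (by omega)) (fne _ _ (by omega))).symm
  · intro i j h1 h2 h3 h4 h5
    rw [hcb (i := j) (by omega), hy h1 (by omega) h3]
    exact (D.cb_Y _ _ _ _).symm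
  · intro i j h1 h2 h3 h4 h5
    rw [hc (i := j) (by omega), hyb h1 (by omega) h3]
    exact (D.swap.cb_Y _ _ _ _).symm
  · intro i h1 h2 h3
    rw [hy h1 (by omega) (by omega), hy (i := i + 1) (by omega) (by omega) (by omega)]
    exact D.Y_Y (nm _ (by omega)) (by rw [WBC.mem_low]; simp only; omega) (sub (by omega))
      (sub (by omega)) (nm _ (by omega))
  · intro i h1 h2 h3
    rw [hyb h1 (by omega) (by omega), hyb (i := i + 1) (by omega) (by omega) (by omega)]
    exact D.swap.Y_Y (nm _ (by omega)) (by rw [WBC.mem_low]; simp only; omega) (sub (by omega))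
      (sub (by omega)) (nm _ (by omega))
  · intro i h1 h2 h3
    rw [WBC.Eb, hE (by omega) (by omega), hc (by omega), hy h1 (by omega) (by omega),
      hyb h1 (by omega) (by omega)]
    have := D.E_swap_commute (a := ⟨i - 1, by omega⟩) (b := ⟨i - 1, by omega⟩)
      (S := WBC.low r i) (S' := WBC.low t i) (nm _ (by omega)) (nm _ (by omega))
    rw [hη, one_mul] at this
    exact this
  · intro i h1 h2 h3
    rw [hE (by omega) (by omega), hy h1 (by omega) (by omega),
      hyb h1 (by omega) (by omega), hL h1 (by omega), hLb h1 (by omega)]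
    exact ⟨D.E_swapY_diff _ _ (nm _ (by omega)), D.E_Y_diff _ _ (nm _ (by omega))⟩
  · intro i h1 h2 h3
    rw [hE (by omega) (by omega), hy h1 (by omega) (by omega), hs (by omega) (by omega),
      D.τ_Y_τ _ (fne _ _ (by omega)) (nm _ (by omega)) (nm _ (by omega))]
    exact D.E_Y (nm _ (by omega)) (fne _ _ (by omega))
      (Or.inr ⟨nm _ (by omega), nm _ (by omega)⟩)
  · intro i h1 h2 h3
    rw [hE (by omega) (by omega), hyb h1 (by omega) (by omega), hsb (by omega) (by omega)]
    have := D.swap.τ_Y_τ (k := ⟨i - 1, by omega⟩) (a := ⟨i, by omega⟩) (S := WBC.low t i)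
      (WBC.low r i) (fne _ _ (by omega)) (nm _ (by omega)) (nm _ (by omega))
    have e : D.τb ⟨i - 1, by omega⟩ ⟨i, by omega⟩ = D.swap.τ ⟨i - 1, by omega⟩ ⟨i, by omega⟩ := rfl
    rw [e, this]
    exact D.swap.E_Y (nm _ (by omega)) (fne _ _ (by omega))
      (Or.inr ⟨nm _ (by omega), nm _ (by omega)⟩)
  · intro i h1 h2 h3
    rw [hc (i := i) (by omega), hc' (by omega), hy h1 (by omega) (by omega),
      hs (by omega) (by omega)]
    have := D.Y_tilde (k := ⟨i - 1, by omega⟩) (a := ⟨i, by omega⟩) (S := WBC.low r i)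
      (WBC.low t i) (fne _ _ (by omega)) (nm _ (by omega)) (nm _ (by omega))
    rw [hη, one_mul] at this
    rw [this]
    refine D.Y_Y ?_ (Finset.mem_insert_self _ _) (Finset.subset_insert _ _)
      (Finset.Subset.refl _) (nm _ (by omega))
    rw [Finset.mem_insert, not_or]
    exact ⟨fne _ _ (by omega), nm _ (by omega)⟩
  · intro i h1 h2 h3
    rw [hcb (i := i) (by omega), hcb' (by omega), hyb h1 (by omega) (by omega),
      hsb (by omega) (by omega)]
    have := D.swap.Y_tilde (k := ⟨i - 1, by omega⟩) (a := ⟨i, by omega⟩) (S := WBC.low t i)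
      (WBC.low r i) (fne _ _ (by omega)) (nm _ (by omega)) (nm _ (by omega))
    have e : D.τb ⟨i - 1, by omega⟩ ⟨i, by omega⟩ = D.swap.τ ⟨i - 1, by omega⟩ ⟨i, by omega⟩ := rfl
    have e1 : D.cb ⟨i - 1, by omega⟩ = D.swap.c ⟨i - 1, by omega⟩ := rfl
    have e2 : D.cb ⟨i, by omega⟩ = D.swap.c ⟨i, by omega⟩ := rfl
    have e3 : D.swap.η = -1 := by rw [← hη]; rfl
    rw [e3, neg_one_mul, sub_neg_eq_add] at this
    rw [e, e1, e2, this]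
    refine D.swap.Y_Y ?_ (Finset.mem_insert_self _ _) (Finset.subset_insert _ _)
      (Finset.Subset.refl _) (nm _ (by omega))
    rw [Finset.mem_insert, not_or]
    exact ⟨fne _ _ (by omega), nm _ (by omega)⟩
  · intro i k h1 h2 h3
    rw [hE (by omega) (by omega), hy h1 (by omega) (by omega), hc (by omega)]
    exact D.bubble _ _ _ _ (nm _ (by omega)) (nm _ (by omega)) _
  · intro i n h1 h2 h3
    rw [hE (by omega) (by omega), hy h1 (by omega) (by omega), hyb h1 (by omega) (by omega)]
    exact ⟨D.even_bubble hA _, D.swap.even_bubble hA _⟩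
  · intro i h1 h2 h3
    rw [hE (by omega) (by omega), hy h1 (by omega) (by omega), hyb h1 (by omega) (by omega)]
    have hcard : (WBC.low r i).card = (WBC.low t i).card := by
      rw [WBC.card_low (by omega), WBC.card_low (by omega)]
    exact ⟨D.one_bubble (nm _ (by omega)) (nm _ (by omega)) hcard,
      D.swap.one_bubble (nm _ (by omega)) (nm _ (by omega)) hcard.symm⟩
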